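/- For every integer k ≥ 1 there exists a constant c_k > 0 such that the following holds for every integer n ≥ 1: if P is a finite set of n points in ℝ² and C is a k-intersecting family of n simple curves, then I(P,C) ≤ c_k · n^((3k+1)/(2k+1)). -/

import Mathlib

open scoped Classical

/-- A simple curve: the image of an injective continuous map from [0,1] into ℝ². -/
def IsSimpleCurve (γ : Set (ℝ × ℝ)) : Prop :=
  ∃ f : Set.Icc (0:ℝ) 1 → ℝ × ℝ, Continuous f ∧ Function.Injective f ∧ γ = Set.range f

/-- A k-intersecting family of simple curves: every member is a simple curve and
any two distinct members intersect in at most k points. -/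
def KIntersecting (C : Finset (Set (ℝ × ℝ))) (k : ℕ) : Prop :=
  (∀ γ ∈ C, IsSimpleCurve γ) ∧
  ∀ γ ∈ C, ∀ γ' ∈ C, γ ≠ γ' → (γ ∩ γ').Finite ∧ (γ ∩ γ').ncard ≤ k

/-- The number of incidences between a finite point set P and a finite family of curves C. -/
noncomputable def incidences (P : Finset (ℝ × ℝ)) (C : Finset (Set (ℝ × ℝ))) : ℕ :=
  ∑ γ ∈ C, (P.filter (fun p => p ∈ γ)).card



theorem ps_lift2 (g : ℝ × ℝ → ℂ) (hg : Continuous g) (h0 : ∀ x, g x ≠ 0) :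
    ∃ f : ℝ × ℝ → ℂ, Continuous f ∧ ∀ x, Complex.exp (f x) = g x := by
  have hs : IsSimplyConnected (Set.univ : Set (ℝ × ℝ)) := by
    have := convex_univ.contractibleSpace (s := (Set.univ : Set (ℝ × ℝ))) Set.univ_nonempty
    unfold IsSimplyConnected
    infer_instance
  obtain ⟨f, hf, he⟩ := Complex.exists_continuousOn_eqOn_exp_comp hs isOpen_univ
    hg.continuousOn (by simpa using h0)
  exact ⟨f, continuousOn_univ.mp hf, fun x => he (Set.mem_univ x)⟩

theorem ps_lift1 (g : ℝ → ℂ) (hg : Continuous g) (h0 : ∀ x, g x ≠ 0) :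
    ∃ f : ℝ → ℂ, Continuous f ∧ ∀ x, Complex.exp (f x) = g x := by
  obtain ⟨f, hf, he⟩ := ps_lift2 (fun x => g x.1) (by fun_prop) (fun x => h0 _)
  exact ⟨fun t => f (t, 0), by fun_prop, fun x => he (x, 0)⟩

theorem ps_uniq (f g : ℝ → ℂ) (hf : Continuous f) (hg : Continuous g) (c : ℂ)
    (h : ∀ t, Complex.exp (f t) = c * Complex.exp (g t)) : f 1 - f 0 = g 1 - g 0 := by
  have h1 : ∀ t, ∃ n : ℤ, (f t - g t) - (f 0 - g 0) = n * (2 * Real.pi * Complex.I) := by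
    intro t
    have : Complex.exp ((f t - g t) - (f 0 - g 0)) = 1 := by
      have hc : c ≠ 0 := by
        intro hc
        have := h 0
        simp [hc] at this
      rw [Complex.exp_sub, Complex.exp_sub, Complex.exp_sub, h t, h 0]
      field_simp
    exact Complex.exp_eq_one_iff.mp this
  choose n hn using h1
  have hn' : ∀ t, (n t : ℝ) = (((f t - g t) - (f 0 - g 0)) / (2 * Real.pi * Complex.I)).re := by
    intro t
    rw [hn t, mul_div_cancel_right₀]
    · simp
    · simp [Real.pi_ne_zero]
  have hc : Continuous (fun t => (n t : ℝ)) := by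
    simp_rw [hn']
    fun_prop
  have hcn : Continuous n := by
    rwa [Int.isClosedEmbedding_coe_real.isEmbedding.continuous_iff]
  have : n 1 = n 0 := PreconnectedSpace.constant inferInstance hcn
  have e1 := hn 1
  have e0 := hn 0
  rw [this, ← e0] at e1
  linear_combination e1

theorem ps_k5_complex (p : Fin 5 → ℂ) (γ : Fin 5 → Fin 5 → ℝ → ℂ)
    (hc : ∀ i j, i < j → Continuous (γ i j))
    (h0 : ∀ i j, i < j → γ i j 0 = p i) (h1 : ∀ i j, i < j → γ i j 1 = p j)
    (hd : ∀ i j k l, i < j → k < l → i ≠ k → i ≠ l → j ≠ k → j ≠ l →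
      ∀ s t, γ i j s ≠ γ k l t) : False := by
  have hv : ∀ i k l, k < l → i ≠ k → i ≠ l → ∀ t, γ k l t - p i ≠ 0 := by
    intro i k l hkl hik hil t
    obtain ⟨j, hj1, hj2, hj3⟩ : ∃ j : Fin 5, j ≠ i ∧ j ≠ k ∧ j ≠ l := by
      revert i k l; decide
    rcases lt_or_gt_of_ne hj1 with h | h
    · have := hd j i k l h hkl hj2 hj3 hik hil 1 t
      rw [h1 j i h] at this
      exact sub_ne_zero.mpr this.symm
    · have := hd i j k l h hkl hik hil hj2 hj3 0 t
      rw [h0 i j h] at this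
      exact sub_ne_zero.mpr this.symm
  have hp : ∀ i j, i ≠ j → p j - p i ≠ 0 := by
    intro i j hij
    obtain ⟨l, hl1, hl2⟩ : ∃ j' : Fin 5, j' ≠ i ∧ j' ≠ j := by
      revert i j; decide
    rcases lt_or_gt_of_ne hl2 with h | h
    · have := hv i l j h hl1.symm hij 1
      rwa [h1 _ _ h] at this
    · have := hv i j l h hij hl1.symm 0
      rwa [h0 _ _ h] at this
  -- lifts
  have hl : ∀ i k l, ∃ f : ℝ → ℂ, k < l → i ≠ k → i ≠ l →
      Continuous f ∧ ∀ x, Complex.exp (f x) = γ k l x - p i := by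
    intro i k l
    by_cases h : k < l ∧ i ≠ k ∧ i ≠ l
    · obtain ⟨f, hf, he⟩ := ps_lift1 (fun t => γ k l t - p i) ((hc k l h.1).sub continuous_const)
        (hv i k l h.1 h.2.1 h.2.2)
      exact ⟨f, fun _ _ _ => ⟨hf, he⟩⟩
    · exact ⟨0, fun a b c => absurd ⟨a, b, c⟩ h⟩
  choose f hf using hl
  set θ : Fin 5 → Fin 5 → ℂ := fun i j => if i < j then Complex.log (p j - p i) else
    Complex.log (p i - p j) + Real.pi * Complex.I with hθ
  have hθe : ∀ i j, i ≠ j → Complex.exp (θ i j) = p j - p i := by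
    intro i j hij
    by_cases h : i < j
    · simp only [hθ, h, if_true]
      exact Complex.exp_log (hp i j hij)
    · simp only [hθ, h, if_false]
      rw [Complex.exp_add, Complex.exp_log (hp j i hij.symm), Complex.exp_pi_mul_I]
      ring
  have hn : ∀ i k l, ∃ n : ℤ, k < l → i ≠ k → i ≠ l →
      f i k l 1 - f i k l 0 = θ i l - θ i k + n * (2 * Real.pi * Complex.I) := by
    intro i k l
    by_cases h : k < l ∧ i ≠ k ∧ i ≠ l
    · obtain ⟨hf1, hf2⟩ := hf i k l h.1 h.2.1 h.2.2
      have : Complex.exp (f i k l 1 - f i k l 0) = Complex.exp (θ i l - θ i k) := by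
        rw [Complex.exp_sub, Complex.exp_sub, hf2, hf2, hθe _ _ h.2.1, hθe _ _ h.2.2,
          h0 _ _ h.1, h1 _ _ h.1]
      obtain ⟨n, hn⟩ := Complex.exp_eq_exp_iff_exists_int.mp this
      exact ⟨n, fun _ _ _ => hn⟩
    · exact ⟨0, fun a b c => absurd ⟨a, b, c⟩ h⟩
  choose n hn using hn
  have hsq : ∀ i j k l, i < j → k < l → i ≠ k → i ≠ l → j ≠ k → j ≠ l →
      (f i k l 1 - f i k l 0) + (f l i j 1 - f l i j 0)
        = (f k i j 1 - f k i j 0) + (f j k l 1 - f j k l 0) := by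
    intro i j k l hij hkl hik hil hjk hjl
    have hcij := hc i j hij
    have hckl := hc k l hkl
    obtain ⟨L, hL, hLe⟩ := ps_lift2 (fun x => γ i j x.1 - γ k l x.2) (by fun_prop)
      (fun x => sub_ne_zero.mpr (hd i j k l hij hkl hik hil hjk hjl _ _))
    have a1 := ps_uniq (fun t => L (0, t)) (f i k l) (by fun_prop) (hf i k l hkl hik hil).1 (-1)
      (fun t => by rw [hLe, (hf i k l hkl hik hil).2]; simp [h0 i j hij])
    have a2 := ps_uniq (fun t => L (1, t)) (f j k l) (by fun_prop) (hf j k l hkl hjk hjl).1 (-1)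
      (fun t => by rw [hLe, (hf j k l hkl hjk hjl).2]; simp [h1 i j hij])
    have a3 := ps_uniq (fun t => L (t, 0)) (f k i j) (by fun_prop)
      (hf k i j hij hik.symm hjk.symm).1 1
      (fun t => by rw [hLe, (hf k i j hij hik.symm hjk.symm).2]; simp [h0 k l hkl])
    have a4 := ps_uniq (fun t => L (t, 1)) (f l i j) (by fun_prop)
      (hf l i j hij hil.symm hjl.symm).1 1
      (fun t => by rw [hLe, (hf l i j hij hil.symm hjl.symm).2]; simp [h1 k l hkl])
    rw [← a1, ← a2, ← a3, ← a4]
    ring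
  set σ : Fin 5 → Fin 5 → ℤ := fun i j => if i < j then -1 else 1 with hσ
  have hσθ : ∀ i j, i ≠ j → θ i j - θ j i = σ i j * (Real.pi * Complex.I) := by
    intro i j hij
    rcases lt_or_gt_of_ne hij with h | h
    · simp [hθ, hσ, h, not_lt.mpr h.le]
    · simp [hθ, hσ, h, not_lt.mpr h.le]
  have key : ∀ i j k l, i < j → k < l → i ≠ k → i ≠ l → j ≠ k → j ≠ l →
      2 * (n i k l + n l i j - n k i j - n j k l) + (σ i l + σ k i + σ l j + σ j k) = 0 := by
    intro i j k l hij hkl hik hil hjk hjl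
    have e := hsq i j k l hij hkl hik hil hjk hjl
    rw [hn i k l hkl hik hil, hn l i j hij hil.symm hjl.symm, hn k i j hij hik.symm hjk.symm,
      hn j k l hkl hjk hjl] at e
    have b1 := hσθ i l hil
    have b2 := hσθ k i hik.symm
    have b3 := hσθ l j hjl.symm
    have b4 := hσθ j k hjk
    have hpi : (Real.pi * Complex.I : ℂ) ≠ 0 := by simp [Real.pi_ne_zero]
    have : ((2 * (n i k l + n l i j - n k i j - n j k l) + (σ i l + σ k i + σ l j + σ j k) : ℤ) : ℂ)
        * (Real.pi * Complex.I) = 0 := by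
      push_cast
      linear_combination e - b1 - b2 - b3 - b4
    have := (mul_eq_zero.mp this).resolve_right hpi
    exact_mod_cast this
  have k1 := key 0 1 2 3 (by decide) (by decide) (by decide) (by decide) (by decide) (by decide)
  have k2 := key 0 2 1 3 (by decide) (by decide) (by decide) (by decide) (by decide) (by decide)
  have k3 := key 0 3 1 2 (by decide) (by decide) (by decide) (by decide) (by decide) (by decide)
  have k4 := key 0 1 2 4 (by decide) (by decide) (by decide) (by decide) (by decide) (by decide)
  have k5 := key 0 2 1 4 (by decide) (by decide) (by decide) (by decide) (by decide) (by decide)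
  have k6 := key 0 4 1 2 (by decide) (by decide) (by decide) (by decide) (by decide) (by decide)
  have k7 := key 0 1 3 4 (by decide) (by decide) (by decide) (by decide) (by decide) (by decide)
  have k8 := key 0 3 1 4 (by decide) (by decide) (by decide) (by decide) (by decide) (by decide)
  have k9 := key 0 4 1 3 (by decide) (by decide) (by decide) (by decide) (by decide) (by decide)
  have k10 := key 0 2 3 4 (by decide) (by decide) (by decide) (by decide) (by decide) (by decide)
  have k11 := key 0 3 2 4 (by decide) (by decide) (by decide) (by decide) (by decide) (by decide)
  have k12 := key 0 4 2 3 (by decide) (by decide) (by decide) (by decide) (by decide) (by decide)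
  have k13 := key 1 2 3 4 (by decide) (by decide) (by decide) (by decide) (by decide) (by decide)
  have k14 := key 1 3 2 4 (by decide) (by decide) (by decide) (by decide) (by decide) (by decide)
  have k15 := key 1 4 2 3 (by decide) (by decide) (by decide) (by decide) (by decide) (by decide)
  clear_value θ
  simp [hσ] at k1 k2 k3 k4 k5 k6 k7 k8 k9 k10 k11 k12 k13 k14 k15
  omega

/-- No drawing of `K₅` in the plane in which disjoint edges do not meet. -/
theorem ps_k5 (p : Fin 5 → ℝ × ℝ) (A : Fin 5 → Fin 5 → Set (ℝ × ℝ))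
    (hA : ∀ i j, i < j → JoinedIn (A i j) (p i) (p j))
    (hd : ∀ i j k l, i < j → k < l → i ≠ k → i ≠ l → j ≠ k → j ≠ l →
      Disjoint (A i j) (A k l)) : False := by
  let e := Complex.equivRealProdCLM.symm
  have : ∀ i j, ∃ g : ℝ → ℂ, i < j → Continuous g ∧ g 0 = e (p i) ∧ g 1 = e (p j) ∧
      ∀ t, ∃ x ∈ A i j, g t = e x := by
    intro i j
    by_cases h : i < j
    · let P := (hA i j h).somePath
      refine ⟨fun t => e (P.extend t), fun _ => ⟨?_, ?_, ?_, ?_⟩⟩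
      · exact e.continuous.comp P.continuous_extend
      · simp
      · simp
      · intro t
        refine ⟨_, ?_, rfl⟩
        exact (hA i j h).somePath_mem _
    · exact ⟨0, fun h' => absurd h' h⟩
  choose γ hγ using this
  refine ps_k5_complex (fun i => e (p i)) γ (fun i j h => (hγ i j h).1)
    (fun i j h => (hγ i j h).2.1) (fun i j h => (hγ i j h).2.2.1) ?_
  intro i j k l hij hkl h1 h2 h3 h4 s t hst
  obtain ⟨x, hx, hx'⟩ := (hγ i j hij).2.2.2 s
  obtain ⟨y, hy, hy'⟩ := (hγ k l hkl).2.2.2 t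
  rw [hx', hy'] at hst
  have := e.injective hst
  subst this
  exact Set.disjoint_left.mp (hd i j k l hij hkl h1 h2 h3 h4) hx hy



/-- Connectedness of the subgraph induced on `S`. -/
def PSConn {V : Type*} (G : SimpleGraph V) (S : Finset V) : Prop :=
  ∀ x ∈ S, ∀ y ∈ S, Relation.ReflTransGen (fun a b => G.Adj a b ∧ a ∈ S ∧ b ∈ S) x y

/-- Degree of `v` into `S`. -/
noncomputable def psDeg {V : Type*} (G : SimpleGraph V) (S : Finset V) (v : V) : ℕ :=
  (S.filter (fun w => G.Adj v w)).card

/-- Number of ordered adjacent pairs inside `S`. -/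
noncomputable def psD {V : Type*} (G : SimpleGraph V) (S : Finset V) : ℕ :=
  ∑ v ∈ S, psDeg G S v

/-- Neighbours of `U` in `W \ U`. -/
noncomputable def psNb {V : Type*} (G : SimpleGraph V) (W U : Finset V) : Finset V :=
  (W \ U).filter (fun w => ∃ u ∈ U, G.Adj u w)

theorem psConn_insert {V : Type*} (G : SimpleGraph V) (S : Finset V) (hS : PSConn G S)
    (u v : V) (hu : u ∈ S) (huv : G.Adj u v) : PSConn G (insert v S) := by
  have mono : ∀ x ∈ S, ∀ y ∈ S, Relation.ReflTransGen
      (fun a b => G.Adj a b ∧ a ∈ insert v S ∧ b ∈ insert v S) x y := by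
    intro x hx y hy
    refine Relation.ReflTransGen.mono ?_ _ _ (hS x hx y hy)
    rintro a b ⟨h1, h2, h3⟩
    exact ⟨h1, Finset.mem_insert_of_mem h2, Finset.mem_insert_of_mem h3⟩
  have e1 : Relation.ReflTransGen
      (fun a b => G.Adj a b ∧ a ∈ insert v S ∧ b ∈ insert v S) u v :=
    Relation.ReflTransGen.single ⟨huv, Finset.mem_insert_of_mem hu, Finset.mem_insert_self _ _⟩
  have e2 : Relation.ReflTransGen
      (fun a b => G.Adj a b ∧ a ∈ insert v S ∧ b ∈ insert v S) v u :=
    Relation.ReflTransGen.single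
      ⟨huv.symm, Finset.mem_insert_self _ _, Finset.mem_insert_of_mem hu⟩
  intro x hx y hy
  rcases Finset.mem_insert.mp hx with rfl | hx'
  · rcases Finset.mem_insert.mp hy with rfl | hy'
    · exact Relation.ReflTransGen.refl
    · exact e2.trans (mono u hu y hy')
  · rcases Finset.mem_insert.mp hy with rfl | hy'
    · exact (mono x hx' u hu).trans e1
    · exact mono x hx' y hy'

theorem psD_erase {V : Type*} (G : SimpleGraph V) (X : Finset V) (v : V) (hv : v ∈ X) :
    psD G X = psD G (X.erase v) + 2 * psDeg G X v := by
  have h1 : psD G X = ∑ w ∈ X.erase v, psDeg G X w + psDeg G X v := by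
    unfold psD
    rw [Finset.sum_erase_add _ _ hv]
  have h2 : ∀ w ∈ X.erase v, psDeg G X w
      = psDeg G (X.erase v) w + if G.Adj v w then 1 else 0 := by
    intro w _
    unfold psDeg
    rw [Finset.filter_erase]
    split_ifs with h
    · rw [Finset.card_erase_add_one]
      simp [hv, h.symm]
    · rw [Finset.erase_eq_of_notMem]
      · rfl
      · simp only [Finset.mem_filter, not_and]
        intro _ h'
        exact h h'.symm
  have h3 : ∑ w ∈ X.erase v, (if G.Adj v w then 1 else 0) = psDeg G X v := by
    rw [← Finset.card_filter]
    unfold psDeg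
    congr 1
    ext w
    simp only [Finset.mem_filter, Finset.mem_erase]
    constructor
    · rintro ⟨⟨_, h⟩, h'⟩; exact ⟨h, h'⟩
    · rintro ⟨h, h'⟩; exact ⟨⟨h'.ne', h⟩, h'⟩
  rw [h1, Finset.sum_congr rfl h2, Finset.sum_add_distrib, h3]
  unfold psD
  ring

theorem psNb_insert {V : Type*} (G : SimpleGraph V) (W U : Finset V) (v : V)
    (hv : v ∈ psNb G W U) :
    (psNb G W U).card + psDeg G (W \ U) v ≤
      (psNb G W (insert v U)).card + 1 + psDeg G (psNb G W U) v := by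
  set N := psNb G W U with hN
  have hsub : (N.erase v) ∪ ((W \ U).filter (fun w => G.Adj v w)) ⊆ psNb G W (insert v U) := by
    intro w hw
    simp only [psNb, hN, Finset.mem_union, Finset.mem_erase, Finset.mem_filter,
      Finset.mem_sdiff, Finset.mem_insert] at hw ⊢
    rcases hw with ⟨h1, ⟨h2, h3⟩, u, hu, huw⟩ | ⟨⟨h2, h3⟩, h4⟩
    · exact ⟨⟨h2, by tauto⟩, u, Or.inr hu, huw⟩
    · exact ⟨⟨h2, by rintro (rfl | h); exacts [h4.ne rfl, h3 h]⟩, v, Or.inl rfl, h4⟩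
  have hc := Finset.card_le_card hsub
  have hui := Finset.card_union_add_card_inter (N.erase v) ((W \ U).filter (fun w => G.Adj v w))
  have hi : ((N.erase v) ∩ ((W \ U).filter (fun w => G.Adj v w))).card ≤ psDeg G N v := by
    unfold psDeg
    apply Finset.card_le_card
    intro w hw
    simp only [Finset.mem_inter, Finset.mem_erase, Finset.mem_filter] at hw ⊢
    exact ⟨hw.1.2, hw.2.2⟩
  have he := Finset.card_erase_add_one hv
  have : psDeg G (W \ U) v = ((W \ U).filter (fun w => G.Adj v w)).card := rfl
  omega

theorem ps_mader_step {V : Type*} (G : SimpleGraph V) (a : ℕ) (ha : 1 ≤ a) :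
    ∀ (s : ℕ) (W : Finset V), W.card = s → W.Nonempty → 2 * a * W.card ≤ psD G W →
    ∃ U N : Finset V, U ⊆ W ∧ N ⊆ W ∧ Disjoint U N ∧ PSConn G U ∧ N.Nonempty ∧
      (∀ v ∈ N, ∃ u ∈ U, G.Adj u v) ∧ ∀ v ∈ N, a ≤ psDeg G N v := by
  intro s
  induction s using Nat.strong_induction_on with
  | _ s ih =>
  intro W hs hW hd
  let good : Finset (Finset V) := W.powerset.filter (fun U => U.Nonempty ∧ PSConn G U ∧
    2 * a * (W.card + 1) ≤ psD G (W \ U) + 2 * (psNb G W U).card + 2 * a * U.card)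
  have hg : good.Nonempty := by
    obtain ⟨v, hv⟩ := hW
    refine ⟨{v}, ?_⟩
    simp only [good, Finset.mem_filter, Finset.mem_powerset, Finset.singleton_subset_iff]
    refine ⟨hv, Finset.singleton_nonempty v, ?_, ?_⟩
    · intro x hx y hy
      rw [Finset.mem_singleton] at hx hy
      subst hx; subst hy
      exact Relation.ReflTransGen.refl
    · have h1 := psD_erase G W v hv
      have h2 : (psNb G W {v}).card = psDeg G W v := by
        unfold psNb psDeg
        congr 1
        ext w
        simp only [Finset.mem_filter, Finset.mem_sdiff, Finset.mem_singleton, exists_eq_left]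
        constructor
        · rintro ⟨⟨h, _⟩, h'⟩; exact ⟨h, h'⟩
        · rintro ⟨h, h'⟩; exact ⟨⟨h, h'.ne'⟩, h'⟩
      rw [Finset.sdiff_singleton_eq_erase, h2, Finset.card_singleton]
      have : 2 * a * (W.card + 1) = 2 * a * W.card + 2 * a * 1 := by ring
      omega
  obtain ⟨U, hU, hmax⟩ := Finset.exists_max_image good Finset.card hg
  have hU' := hU
  simp only [good, Finset.mem_filter, Finset.mem_powerset] at hU'
  obtain ⟨hUW, hUne, hUc, hUφ⟩ := hU'
  have hWU : (W \ U).card + U.card = W.card := Finset.card_sdiff_add_card_eq_card hUW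
  by_cases hNe : (psNb G W U).Nonempty
  · refine ⟨U, psNb G W U, hUW, ?_, ?_, hUc, hNe, ?_, ?_⟩
    · exact (Finset.filter_subset _ _).trans Finset.sdiff_subset
    · rw [Finset.disjoint_left]
      intro x hx hx'
      simp only [psNb, Finset.mem_filter, Finset.mem_sdiff] at hx'
      exact hx'.1.2 hx
    · intro v hv
      simp only [psNb, Finset.mem_filter] at hv
      exact hv.2
    · intro v hv
      by_contra hlt
      push Not at hlt
      have hv' := hv
      simp only [psNb, Finset.mem_filter, Finset.mem_sdiff] at hv'
      obtain ⟨⟨hvW, hvU⟩, u, hu, huv⟩ := hv'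
      have hin : insert v U ∈ good := by
        simp only [good, Finset.mem_filter, Finset.mem_powerset]
        refine ⟨Finset.insert_subset hvW hUW, Finset.insert_nonempty _ _,
          psConn_insert G U hUc u v hu huv, ?_⟩
        have h1 := psD_erase G (W \ U) v (Finset.mem_sdiff.mpr ⟨hvW, hvU⟩)
        have h2 := psNb_insert G W U v hv
        have h3 : W \ insert v U = (W \ U).erase v := by
          ext w; simp only [Finset.mem_sdiff, Finset.mem_insert, Finset.mem_erase]; tauto
        rw [h3, Finset.card_insert_of_notMem hvU]
        have : 2 * a * (U.card + 1) = 2 * a * U.card + 2 * a := by ring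
        omega
      have := hmax _ hin
      rw [Finset.card_insert_of_notMem hvU] at this
      omega
  · rw [Finset.not_nonempty_iff_eq_empty] at hNe
    rw [hNe, Finset.card_empty] at hUφ
    have hsum : 2 * a * W.card = 2 * a * (W \ U).card + 2 * a * U.card := by rw [← hWU]; ring
    have hexp : 2 * a * (W.card + 1) = 2 * a * W.card + 2 * a := by ring
    have hne : (W \ U).Nonempty := by
      by_contra h
      rw [Finset.not_nonempty_iff_eq_empty] at h
      rw [h] at hUφ hsum
      have hz : psD G (∅ : Finset V) = 0 := by simp [psD]
      rw [hz] at hUφ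
      rw [Finset.card_empty] at hsum
      omega
    have hUpos := Finset.card_pos.mpr hUne
    obtain ⟨U', N, h1, h2, h3⟩ := ih (W \ U).card (by omega) (W \ U) rfl hne (by omega)
    exact ⟨U', N, h1.trans Finset.sdiff_subset, h2.trans Finset.sdiff_subset, h3⟩

theorem ps_mader {V : Type*} (G : SimpleGraph V) (L : List (Fin 5 × Fin 5)) :
    ∀ W : Finset V, W.Nonempty → 5 * 4 ^ L.length * W.card ≤ psD G W →
    ∃ (f : Fin 5 → V) (S : Fin 5 → Fin 5 → Finset V), Function.Injective f ∧ (∀ i, f i ∈ W) ∧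
      (∀ e ∈ L, S e.1 e.2 ⊆ W ∧ PSConn G (S e.1 e.2) ∧ f e.1 ∈ S e.1 e.2 ∧ f e.2 ∈ S e.1 e.2 ∧
        ∀ m, f m ∈ S e.1 e.2 → m = e.1 ∨ m = e.2) ∧
      (∀ e ∈ L, ∀ e' ∈ L, e.1 ≠ e'.1 → e.1 ≠ e'.2 → e.2 ≠ e'.1 → e.2 ≠ e'.2 →
        Disjoint (S e.1 e.2) (S e'.1 e'.2)) := by
  induction L with
  | nil =>
    intro W hW hd
    have h5 : 5 ≤ W.card := by
      have : psD G W ≤ W.card * W.card := by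
        unfold psD
        calc _ ≤ ∑ v ∈ W, W.card := Finset.sum_le_sum (fun v _ => Finset.card_filter_le _ _)
          _ = _ := by simp
      have hpos := Finset.card_pos.mpr hW
      simp only [List.length_nil, pow_zero, mul_one] at hd
      exact Nat.le_of_mul_le_mul_right (hd.trans this) hpos
    obtain ⟨T, hT, hTc⟩ := Finset.exists_subset_card_eq h5
    let e := (T.equivFinOfCardEq hTc).symm
    refine ⟨fun i => (e i : V), fun _ _ => ∅, ?_, fun i => hT (e i).2, by simp, by simp⟩
    exact Subtype.val_injective.comp e.injective
  | cons q L ih =>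
    obtain ⟨i, j⟩ := q
    intro W hW hd
    obtain ⟨U, N, hUW, hNW, hUN, hUc, hNne, hNU, hNd⟩ :=
      ps_mader_step G (10 * 4 ^ L.length) (Nat.one_le_iff_ne_zero.mpr (by positivity)) _ W rfl hW
        (by simp only [List.length_cons, pow_succ] at hd; linarith)
    obtain ⟨f, S, hf, hfN, hS, hSd⟩ := ih N hNne (by
      unfold psD
      calc _ ≤ 10 * 4 ^ L.length * N.card := by
            apply Nat.mul_le_mul_right; apply Nat.mul_le_mul_right; norm_num
        _ = ∑ v ∈ N, 10 * 4 ^ L.length := by simp [mul_comm]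
        _ ≤ _ := Finset.sum_le_sum hNd)
    have hfU : ∀ m, f m ∉ U := fun m h => Finset.disjoint_left.mp hUN h (hfN m)
    set S' : Fin 5 → Fin 5 → Finset V := fun a b =>
      if (a, b) = (i, j) then insert (f i) (insert (f j) U) else S a b with hS'
    have hnew : S' i j = insert (f i) (insert (f j) U) := by simp [hS']
    have hold : ∀ e : Fin 5 × Fin 5, e ≠ (i, j) → S' e.1 e.2 = S e.1 e.2 := by
      intro e he
      simp only [hS']
      rw [if_neg]
      exact he
    have hdis : ∀ e ∈ L, i ≠ e.1 → i ≠ e.2 → j ≠ e.1 → j ≠ e.2 →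
        Disjoint (insert (f i) (insert (f j) U)) (S e.1 e.2) := by
      intro e he h1 h2 h3 h4
      obtain ⟨hs1, hs2, hs3, hs4, hs5⟩ := hS e he
      rw [Finset.disjoint_left]
      intro x hx hx'
      simp only [Finset.mem_insert] at hx
      rcases hx with rfl | rfl | hx
      · rcases hs5 _ hx' with h | h
        exacts [h1 h, h2 h]
      · rcases hs5 _ hx' with h | h
        exacts [h3 h, h4 h]
      · exact Finset.disjoint_left.mp hUN hx (hs1 hx')
    refine ⟨f, S', hf, fun m => hNW (hfN m), ?_, ?_⟩
    · intro e he
      by_cases hee : e = (i, j)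
      · subst hee
        simp only [hnew]
        refine ⟨?_, ?_, by simp, by simp, ?_⟩
        · intro x hx
          simp only [Finset.mem_insert] at hx
          rcases hx with rfl | rfl | hx
          exacts [hNW (hfN _), hNW (hfN _), hUW hx]
        · obtain ⟨u, hu, huv⟩ := hNU _ (hfN i)
          obtain ⟨u', hu', huv'⟩ := hNU _ (hfN j)
          exact psConn_insert G _ (psConn_insert G U hUc u' _ hu' huv') u _
            (Finset.mem_insert_of_mem hu) huv
        · intro m hm
          simp only [Finset.mem_insert] at hm
          rcases hm with h | h | h
          · exact Or.inl (hf h)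
          · exact Or.inr (hf h)
          · exact absurd h (hfU m)
      · rw [hold e hee]
        have heL : e ∈ L := by
          rcases List.mem_cons.mp he with h | h
          exacts [absurd h hee, h]
        obtain ⟨hs1, hs2⟩ := hS e heL
        exact ⟨hs1.trans hNW, hs2⟩
    · intro e he e' he' h1 h2 h3 h4
      by_cases hee : e = (i, j)
      · by_cases hee' : e' = (i, j)
        · rw [hee, hee'] at h1
          exact absurd rfl h1
        · have heL : e' ∈ L := by
            rcases List.mem_cons.mp he' with h | h
            exacts [absurd h hee', h]
          rw [hold e' hee']
          subst hee
          simp only [hnew]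
          exact hdis e' heL h1 h2 h3 h4
      · have heL : e ∈ L := by
          rcases List.mem_cons.mp he with h | h
          exacts [absurd h hee, h]
        by_cases hee' : e' = (i, j)
        · rw [hold e hee]
          subst hee'
          simp only [hnew]
          exact (hdis e heL h1.symm h3.symm h2.symm h4.symm).symm
        · have heL' : e' ∈ L := by
            rcases List.mem_cons.mp he' with h | h
            exacts [absurd h hee', h]
          rw [hold e hee, hold e' hee']
          exact hSd e heL e' heL' h1 h2 h3 h4

/-- A drawing in which independent edges are disjoint has linearly many edges. -/
theorem ps_linear {V : Type*} (G : SimpleGraph V) (p : V → ℝ × ℝ) (A : V → V → Set (ℝ × ℝ))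
    (hA : ∀ u v, G.Adj u v → JoinedIn (A u v) (p u) (p v))
    (hd : ∀ u v x y, G.Adj u v → G.Adj x y → u ≠ x → u ≠ y → v ≠ x → v ≠ y →
      Disjoint (A u v) (A x y)) (W : Finset V) :
    psD G W ≤ 5 * 4 ^ 10 * W.card := by
  by_contra hlt
  push Not at hlt
  have hW : W.Nonempty := by
    by_contra h
    rw [Finset.not_nonempty_iff_eq_empty] at h
    subst h
    simp [psD] at hlt
  let L : List (Fin 5 × Fin 5) := [(0,1),(0,2),(0,3),(0,4),(1,2),(1,3),(1,4),(2,3),(2,4),(3,4)]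
  obtain ⟨f, S, hf, -, hS, hSd⟩ := ps_mader G L W hW hlt.le
  have hL : ∀ i j : Fin 5, i < j → (i, j) ∈ L := by decide
  let B : Finset V → Set (ℝ × ℝ) := fun T => {z | ∃ u ∈ T, ∃ v ∈ T, G.Adj u v ∧ z ∈ A u v}
  refine ps_k5 (fun i => p (f i)) (fun i j => B (S i j)) ?_ ?_
  · intro i j hij
    obtain ⟨hs1, hs2, hs3, hs4, -⟩ := hS (i, j) (hL i j hij)
    simp only at hs1 hs2 hs3 hs4
    have key : ∀ x y, Relation.ReflTransGen (fun a b => G.Adj a b ∧ a ∈ S i j ∧ b ∈ S i j) x y →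
        x = y ∨ JoinedIn (B (S i j)) (p x) (p y) := by
      intro x y h
      induction h with
      | refl => exact Or.inl rfl
      | tail h1 h2 ih =>
        rename_i b c
        have : JoinedIn (B (S i j)) (p b) (p c) :=
          (hA b c h2.1).mono (fun z hz => ⟨b, h2.2.1, c, h2.2.2, h2.1, hz⟩)
        rcases ih with rfl | ih
        · exact Or.inr this
        · exact Or.inr (ih.trans this)
    rcases key _ _ (hs2 _ hs3 _ hs4) with h | h
    · exact absurd (hf h) hij.ne
    · exact h
  · intro i j k l hij hkl h1 h2 h3 h4
    have := hSd (i, j) (hL i j hij) (k, l) (hL k l hkl) h1 h2 h3 h4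
    simp only at this
    rw [Set.disjoint_left]
    rintro z ⟨u, hu, v, hv, huv, hz⟩ ⟨x, hx, y, hy, hxy, hz'⟩
    have hne : ∀ a ∈ S i j, ∀ b ∈ S k l, a ≠ b := by
      rintro a ha b hb rfl
      exact Finset.disjoint_left.mp this ha hb
    exact Set.disjoint_left.mp (hd u v x y huv hxy (hne _ hu _ hx) (hne _ hu _ hy)
      (hne _ hv _ hx) (hne _ hv _ hy)) hz hz'



/-- Two arcs (indexed by curve and end vertices) are independent and intersect. -/
def PSCross {V Γ : Type*} (A : Γ → V → V → Set (ℝ × ℝ)) (e e' : Γ × V × V) : Prop :=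
  e.2.1 ≠ e'.2.1 ∧ e.2.1 ≠ e'.2.2 ∧ e.2.2 ≠ e'.2.1 ∧ e.2.2 ≠ e'.2.2 ∧
    ¬ Disjoint (A e.1 e.2.1 e.2.2) (A e'.1 e'.2.1 e'.2.2)

theorem ps_det {V Γ : Type*} (p : V → ℝ × ℝ) (A : Γ → V → V → Set (ℝ × ℝ))
    (hsymA : ∀ γ a b, A γ a b = A γ b a) (F : Finset (Γ × V × V)) (W : Finset V)
    (hsym : ∀ γ a b, (γ, a, b) ∈ F → (γ, b, a) ∈ F)
    (hne : ∀ γ a b, (γ, a, b) ∈ F → a ≠ b)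
    (hsimple : ∀ γ γ' a b, (γ, a, b) ∈ F → (γ', a, b) ∈ F → γ = γ')
    (hW : ∀ γ a b, (γ, a, b) ∈ F → a ∈ W)
    (hA : ∀ γ a b, (γ, a, b) ∈ F → JoinedIn (A γ a b) (p a) (p b)) :
    F.card ≤ 5 * 4 ^ 10 * W.card +
      ((F ×ˢ F).filter (fun q => PSCross A q.1 q.2)).card := by
  set F' := F.filter (fun e => ∀ e' ∈ F, ¬ PSCross A e e') with hF'
  set X := (F ×ˢ F).filter (fun q => PSCross A q.1 q.2) with hX
  have h1 : F.card ≤ F'.card + X.card := by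
    have hsub : F ⊆ F' ∪ X.image Prod.fst := by
      intro e he
      rw [Finset.mem_union]
      by_cases h : e ∈ F'
      · exact Or.inl h
      · right
        simp only [hF', Finset.mem_filter, he, true_and, not_forall, not_not] at h
        obtain ⟨e', he', hx⟩ := h
        exact Finset.mem_image.mpr ⟨(e, e'), by simp [hX, he, he', hx], rfl⟩
    calc F.card ≤ _ := Finset.card_le_card hsub
      _ ≤ _ := Finset.card_union_le _ _
      _ ≤ _ := by gcongr; exact Finset.card_image_le
  have hsym' : ∀ γ a b, (γ, a, b) ∈ F' → (γ, b, a) ∈ F' := by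
    intro γ a b h
    simp only [hF', Finset.mem_filter] at h ⊢
    refine ⟨hsym _ _ _ h.1, fun e' he' hc => h.2 e' he' ?_⟩
    simp only [PSCross] at hc ⊢
    rw [hsymA γ b a] at hc
    tauto
  let G : SimpleGraph V :=
    { Adj := fun a b => ∃ γ, (γ, a, b) ∈ F'
      symm := ⟨fun a b ⟨γ, h⟩ => ⟨γ, hsym' _ _ _ h⟩⟩
      loopless := ⟨fun a ⟨γ, h⟩ => hne _ _ _ (Finset.mem_filter.mp h).1 rfl⟩ }
  have h2 : ∀ a b, G.Adj a b ↔ ∃ γ, (γ, a, b) ∈ F' := fun a b => Iff.rfl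
  have hch : ∀ a b, ∃ S : Set (ℝ × ℝ), G.Adj a b → ∃ γ, (γ, a, b) ∈ F' ∧ S = A γ a b := by
    intro a b
    by_cases h : G.Adj a b
    · obtain ⟨γ, hγ⟩ := h
      exact ⟨A γ a b, fun _ => ⟨γ, hγ, rfl⟩⟩
    · exact ⟨∅, fun h' => absurd h' h⟩
  choose A' hA' using hch
  have h3 := ps_linear G p A' (by
      intro u v huv
      obtain ⟨γ, hγ, he⟩ := hA' u v huv
      rw [he]
      exact hA _ _ _ (Finset.mem_filter.mp hγ).1) (by
      intro u v x y huv hxy n1 n2 n3 n4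
      obtain ⟨γ, hγ, he⟩ := hA' u v huv
      obtain ⟨γ', hγ', he'⟩ := hA' x y hxy
      rw [he, he']
      by_contra hd
      exact (Finset.mem_filter.mp hγ).2 _ (Finset.mem_filter.mp hγ').1 ⟨n1, n2, n3, n4, hd⟩) W
  have h4 : F'.card ≤ psD G W := by
    unfold psD psDeg
    rw [← Finset.card_sigma]
    refine Finset.card_le_card_of_injOn (fun e => ⟨e.2.1, e.2.2⟩) ?_ ?_
    · rintro ⟨γ, a, b⟩ he
      have he : (γ, a, b) ∈ F' := he
      have heF := (Finset.mem_filter.mp he).1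
      simp only [Finset.coe_sigma, Set.mem_sigma_iff, Finset.mem_coe, Finset.mem_filter]
      exact ⟨hW _ _ _ heF, hW _ _ _ (hsym _ _ _ heF), γ, he⟩
    · rintro ⟨γ, a, b⟩ he ⟨γ', a', b'⟩ he' heq
      have he : (γ, a, b) ∈ F' := he
      have he' : (γ', a', b') ∈ F' := he'
      simp only [Sigma.mk.injEq, heq_eq_eq] at heq
      obtain ⟨rfl, rfl⟩ := heq
      rw [hsimple _ _ _ _ (Finset.mem_filter.mp he).1 (Finset.mem_filter.mp he').1]
  omega

theorem ps_count {α : Type*} [Fintype α] (M : ℕ) (T : Finset α) (g : α → Fin M) :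
    (Finset.univ.filter (fun c : α → Fin M => ∀ x ∈ T, c x = g x)).card * M ^ T.card
      = M ^ Fintype.card α := by
  have : Finset.univ.filter (fun c : α → Fin M => ∀ x ∈ T, c x = g x)
      = Fintype.piFinset (fun x => if x ∈ T then {g x} else Finset.univ) := by
    ext c
    simp only [Finset.mem_filter, Finset.mem_univ, true_and, Fintype.mem_piFinset]
    refine forall_congr' fun x => ?_
    split_ifs with h <;> simp [h]
  rw [this, Fintype.card_piFinset]
  have h2 : ∀ x, (if x ∈ T then ({g x} : Finset (Fin M)) else Finset.univ).card
      = if x ∈ T then 1 else M := by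
    intro x; split_ifs <;> simp
  simp_rw [h2]
  rw [Finset.prod_ite]
  simp only [Finset.prod_const, one_pow, one_mul]
  rw [← pow_add]
  congr 1
  have := Finset.card_filter_add_card_filter_not (s := (Finset.univ : Finset α)) (fun x => x ∈ T)
  simp only [Finset.filter_mem_eq_inter, Finset.univ_inter, Finset.card_univ] at this
  omega

theorem ps_count2 {α β : Type*} [Fintype α] [Fintype β] (M t : ℕ) (T : Finset α) (g : α → Fin M)
    (T' : Finset β) (g' : β → Fin t) (s : Finset ((α → Fin M) × (β → Fin t)))
    (hs : ∀ ω, ω ∈ s ↔ (∀ x ∈ T, ω.1 x = g x) ∧ ∀ x ∈ T', ω.2 x = g' x) :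
    s.card * (M ^ T.card * t ^ T'.card) = M ^ Fintype.card α * t ^ Fintype.card β := by
  have h1 := ps_count M T g
  have h2 := ps_count t T' g'
  have : s = (Finset.univ.filter (fun c : α → Fin M => ∀ x ∈ T, c x = g x)) ×ˢ
      (Finset.univ.filter (fun c : β → Fin t => ∀ x ∈ T', c x = g' x)) := by
    ext ω
    rw [hs, Finset.mem_product, Finset.mem_filter, Finset.mem_filter]
    simp
  rw [this, Finset.card_product, ← h1, ← h2]
  ring

theorem ps_dc {Ω β : Type*} [Fintype Ω] (E : Finset β) (sel : Ω → β → Prop) (F : Ω → Finset β)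
    (hF : ∀ ω e, e ∈ F ω ↔ e ∈ E ∧ sel ω e) (q Q : ℕ)
    (hc : ∀ e ∈ E, ∀ s : Finset Ω, (∀ ω, ω ∈ s ↔ sel ω e) → s.card * q = Q) :
    (∑ ω, (F ω).card) * q = E.card * Q := by
  have h1 : ∀ ω, (F ω).card = ∑ e ∈ E, if sel ω e then 1 else 0 := by
    intro ω
    rw [← Finset.card_filter]
    congr 1
    ext e
    rw [hF, Finset.mem_filter]
  rw [Finset.sum_congr rfl (fun ω _ => h1 ω), Finset.sum_comm, Finset.sum_mul]
  have h2 : ∀ e ∈ E, (∑ ω, if sel ω e then 1 else 0) * q = Q := by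
    intro e he
    rw [← Finset.card_filter]
    exact hc e he _ (fun ω => by simp)
  rw [Finset.sum_congr rfl h2]
  simp

/-- Sampled version of the crossing lemma for multigraphs with multiplicity at most `M`. -/
theorem ps_crossing {V Γ : Type*} [Fintype V] [Fintype Γ] (p : V → ℝ × ℝ)
    (A : Γ → V → V → Set (ℝ × ℝ))
    (hsymA : ∀ γ a b, A γ a b = A γ b a) (E : Finset (Γ × V × V))
    (hsym : ∀ γ a b, (γ, a, b) ∈ E → (γ, b, a) ∈ E)
    (hne : ∀ γ a b, (γ, a, b) ∈ E → a ≠ b)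
    (hA : ∀ γ a b, (γ, a, b) ∈ E → JoinedIn (A γ a b) (p a) (p b))
    (M t : ℕ) (hM : 1 ≤ M) (ht : 1 ≤ t)
    (hmult : ∀ a b, (Finset.univ.filter (fun γ => (γ, a, b) ∈ E)).card ≤ M) :
    E.card * M * t ^ 2 ≤ 5 * 4 ^ 10 * Fintype.card V * M ^ 2 * t ^ 3 +
      ((E ×ˢ E).filter (fun q => PSCross A q.1 q.2)).card := by
  -- index function
  have hidx : ∀ e : Sym2 V, ∃ f : Γ → Fin M, ∀ a b, e = s(a, b) → ∀ γ γ', (γ, a, b) ∈ E →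
      (γ', a, b) ∈ E → f γ = f γ' → γ = γ' := by
    intro e
    induction e using Sym2.ind with
    | _ a b =>
    set S := Finset.univ.filter (fun γ => (γ, a, b) ∈ E) with hS
    have hc : S.card ≤ Fintype.card (Fin M) := by simpa using hmult a b
    obtain ⟨f, hf⟩ : ∃ f : S → Fin M, Function.Injective f := by
      have : Nonempty (S ↪ Fin M) := Function.Embedding.nonempty_of_card_le (by simpa using hmult a b)
      exact ⟨this.some, this.some.injective⟩
    refine ⟨fun γ => if h : γ ∈ S then f ⟨γ, h⟩ else ⟨0, hM⟩, ?_⟩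
    intro a' b' hab γ γ' hγ hγ' heq
    have hm : ∀ δ, (δ, a', b') ∈ E → δ ∈ S := by
      intro δ hδ
      simp only [hS, Finset.mem_filter, Finset.mem_univ, true_and]
      rcases Sym2.eq_iff.mp hab with ⟨rfl, rfl⟩ | ⟨rfl, rfl⟩
      · exact hδ
      · exact hsym _ _ _ hδ
    simp only [hm γ hγ, hm γ' hγ', dif_pos] at heq
    exact congrArg Subtype.val (hf heq)
  choose idx hidx using hidx
  let z : Fin t := ⟨0, ht⟩
  let sel : ((Sym2 V → Fin M) × (V → Fin t)) → Γ × V × V → Prop := fun ω e =>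
    (∀ x ∈ ({s(e.2.1, e.2.2)} : Finset (Sym2 V)), ω.1 x = idx x e.1) ∧
      ∀ x ∈ ({e.2.1, e.2.2} : Finset V), ω.2 x = z
  set X := (E ×ˢ E).filter (fun q => PSCross A q.1 q.2) with hX
  have main : ∀ ω : (Sym2 V → Fin M) × (V → Fin t), (E.filter (sel ω)).card ≤
      5 * 4 ^ 10 * (Finset.univ.filter (fun v => ω.2 v = z)).card +
        (X.filter (fun q => sel ω q.1 ∧ sel ω q.2)).card := by
    intro ω
    have := ps_det p A hsymA (E.filter (sel ω)) (Finset.univ.filter (fun v => ω.2 v = z))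
      (by
        intro γ a b h
        simp only [Finset.mem_filter, sel] at h ⊢
        refine ⟨hsym _ _ _ h.1, ?_, ?_⟩
        · rw [Sym2.eq_swap]; exact h.2.1
        · rw [Finset.pair_comm]; exact h.2.2)
      (fun γ a b h => hne _ _ _ (Finset.mem_filter.mp h).1)
      (by
        intro γ γ' a b h h'
        simp only [Finset.mem_filter, sel, Finset.mem_singleton, forall_eq] at h h'
        exact hidx _ a b rfl γ γ' h.1 h'.1 (h.2.1.symm.trans h'.2.1))
      (by
        intro γ a b h
        simp only [Finset.mem_filter, sel] at h ⊢
        exact ⟨Finset.mem_univ _, h.2.2 a (by simp)⟩)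
      (fun γ a b h => hA _ _ _ (Finset.mem_filter.mp h).1)
    refine this.trans ?_
    gcongr
    intro q hq
    simp only [Finset.mem_filter, Finset.mem_product, hX] at hq ⊢
    tauto
  set Q := M ^ Fintype.card (Sym2 V) * t ^ Fintype.card V with hQ
  have hsum := Finset.sum_le_sum (fun ω (_ : ω ∈ (Finset.univ : Finset ((Sym2 V → Fin M) × (V → Fin t)))) => main ω)
  -- double counting
  have sE := ps_dc E sel (fun ω => E.filter (sel ω)) (by simp) (M * t ^ 2) Q (by
    rintro ⟨γ, a, b⟩ he s hs
    have := ps_count2 M t ({s(a, b)} : Finset (Sym2 V)) (fun x => idx x γ) {a, b} (fun _ => z) s hs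
    rwa [Finset.card_singleton, pow_one, Finset.card_pair (hne _ _ _ he)] at this)
  have sV := ps_dc (Finset.univ : Finset V) (fun (ω : (Sym2 V → Fin M) × (V → Fin t)) v => ω.2 v = z)
    (fun ω => Finset.univ.filter (fun v => ω.2 v = z)) (by simp) t Q (by
    rintro v _ s hs
    have := ps_count2 M t (∅ : Finset (Sym2 V)) (fun x => ⟨0, hM⟩) {v} (fun _ => z) s
      (by simpa using hs)
    rwa [Finset.card_singleton, pow_one, Finset.card_empty, pow_zero, one_mul] at this)
  have sX := ps_dc X (fun ω q => sel ω q.1 ∧ sel ω q.2)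
    (fun ω => X.filter (fun q => sel ω q.1 ∧ sel ω q.2)) (by simp) (M ^ 2 * t ^ 4) Q (by
    rintro ⟨⟨γ, a, b⟩, ⟨γ', x, y⟩⟩ hq s hs
    rw [hX, Finset.mem_filter, Finset.mem_product] at hq
    obtain ⟨⟨he, he'⟩, n1, n2, n3, n4, -⟩ := hq
    simp only at he he' n1 n2 n3 n4
    have hnab := hne _ _ _ he
    have hnxy := hne _ _ _ he'
    have hss : s(a, b) ≠ s(x, y) := by
      intro h
      rcases Sym2.eq_iff.mp h with ⟨h, _⟩ | ⟨h, _⟩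
      exacts [n1 h, n2 h]
    have hc4 : ({a, b, x, y} : Finset V).card = 4 := by
      rw [Finset.card_insert_of_notMem, Finset.card_insert_of_notMem, Finset.card_pair hnxy]
      · simp [n3, n4]
      · simp [n1, n2, hnab]
    have := ps_count2 M t ({s(a, b), s(x, y)} : Finset (Sym2 V))
      (fun e => if e = s(a, b) then idx e γ else idx e γ') {a, b, x, y} (fun _ => z) s (by
        intro ω
        rw [hs]
        simp only [sel, Finset.mem_insert, if_true,
          Finset.mem_singleton, forall_eq_or_imp, forall_eq, hss.symm, if_false]
        tauto)
    rwa [Finset.card_pair hss, hc4] at this)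
  rw [Finset.card_univ] at sV
  rw [Finset.sum_add_distrib, ← Finset.mul_sum] at hsum
  have hQpos : 0 < Q := by positivity
  set a := ∑ ω : (Sym2 V → Fin M) × (V → Fin t), (E.filter (sel ω)).card
  set b := ∑ ω : (Sym2 V → Fin M) × (V → Fin t), (Finset.univ.filter (fun v => ω.2 v = z)).card
  set c := ∑ ω : (Sym2 V → Fin M) × (V → Fin t), (X.filter (fun q => sel ω q.1 ∧ sel ω q.2)).card
  refine Nat.le_of_mul_le_mul_right ?_ hQpos
  calc E.card * M * t ^ 2 * Q = (E.card * Q) * (M * t ^ 2) := by ring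
    _ = a * (M ^ 2 * t ^ 4) := by rw [← sE]; ring
    _ ≤ (5 * 4 ^ 10 * b + c) * (M ^ 2 * t ^ 4) := by gcongr
    _ = 5 * 4 ^ 10 * (b * t) * M ^ 2 * t ^ 3 + c * (M ^ 2 * t ^ 4) := by ring
    _ ≤ 5 * 4 ^ 10 * (Fintype.card V * Q) * M ^ 2 * t ^ 3 + X.card * Q := by rw [sV, sX]
    _ = _ := by ring



/-- Points and parametrized simple curves, any two curves meeting in at most `k` points. -/
structure PSData (V Γ : Type*) (k : ℕ) where
  p : V → ℝ × ℝ
  p_inj : Function.Injective p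
  g : Γ → ℝ → ℝ × ℝ
  g_cont : ∀ γ, Continuous (g γ)
  g_inj : ∀ γ, Set.InjOn (g γ) (Set.Icc 0 1)
  on : Γ → V → Prop
  pos : Γ → V → ℝ
  pos_mem : ∀ γ v, on γ v → pos γ v ∈ Set.Icc (0:ℝ) 1
  g_pos : ∀ γ v, on γ v → g γ (pos γ v) = p v
  on_of : ∀ γ v s, s ∈ Set.Icc (0:ℝ) 1 → g γ s = p v → on γ v
  inter : ∀ γ γ', γ ≠ γ' → ∃ I : Finset (ℝ × ℝ), I.card ≤ k ∧
    ∀ s ∈ Set.Icc (0:ℝ) 1, ∀ t ∈ Set.Icc (0:ℝ) 1, g γ s = g γ' t → g γ s ∈ I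

namespace PSData

variable {V Γ : Type*} {k : ℕ} (d : PSData V Γ k)

/-- Consecutive points on a curve. -/
def Edge (γ : Γ) (a b : V) : Prop :=
  d.on γ a ∧ d.on γ b ∧ a ≠ b ∧ ∀ c, d.on γ c →
    ¬ (d.pos γ a < d.pos γ c ∧ d.pos γ c < d.pos γ b) ∧
    ¬ (d.pos γ b < d.pos γ c ∧ d.pos γ c < d.pos γ a)

/-- The arc of a curve between two of its points. -/
def arc (γ : Γ) (a b : V) : Set (ℝ × ℝ) := d.g γ '' Set.uIcc (d.pos γ a) (d.pos γ b)

theorem arc_symm (γ : Γ) (a b : V) : d.arc γ a b = d.arc γ b a := by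
  unfold arc; rw [Set.uIcc_comm]

theorem Edge.symm {d : PSData V Γ k} {γ : Γ} {a b : V} (h : d.Edge γ a b) : d.Edge γ b a :=
  ⟨h.2.1, h.1, h.2.2.1.symm, fun c hc => ⟨(h.2.2.2 c hc).2, (h.2.2.2 c hc).1⟩⟩

theorem pos_inj (γ : Γ) (a b : V) (ha : d.on γ a) (hb : d.on γ b)
    (h : d.pos γ a = d.pos γ b) : a = b := by
  apply d.p_inj
  rw [← d.g_pos γ a ha, ← d.g_pos γ b hb, h]

theorem joined (γ : Γ) (a b : V) (h : d.Edge γ a b) : JoinedIn (d.arc γ a b) (d.p a) (d.p b) := by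
  have h1 : JoinedIn (Set.uIcc (d.pos γ a) (d.pos γ b)) (d.pos γ a) (d.pos γ b) := by
    have : IsPathConnected (Set.uIcc (d.pos γ a) (d.pos γ b)) :=
      (convex_uIcc _ _).isPathConnected ⟨_, Set.left_mem_uIcc⟩
    exact this.joinedIn _ Set.left_mem_uIcc _ Set.right_mem_uIcc
  have h2 := h1.map_continuousOn (f := d.g γ) (d.g_cont γ).continuousOn
  rwa [d.g_pos γ a h.1, d.g_pos γ b h.2.1] at h2

theorem uIcc_sub (γ : Γ) (a b : V) (ha : d.on γ a) (hb : d.on γ b) {s : ℝ}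
    (hs : s ∈ Set.uIcc (d.pos γ a) (d.pos γ b)) : s ∈ Set.Icc (0:ℝ) 1 :=
  Set.uIcc_subset_Icc (d.pos_mem γ a ha) (d.pos_mem γ b hb) hs

/-- A vertex on an arc is one of its ends. -/
theorem edge_vertex (γ : Γ) (a b c : V) (h : d.Edge γ a b) (hc : d.on γ c)
    (hs : d.pos γ c ∈ Set.uIcc (d.pos γ a) (d.pos γ b)) : c = a ∨ c = b := by
  obtain ⟨ha, hb, hab, hn⟩ := h
  obtain ⟨n1, n2⟩ := hn c hc
  by_contra hcon
  push Not at hcon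
  have e1 : d.pos γ c ≠ d.pos γ a := fun h => hcon.1 (d.pos_inj γ _ _ hc ha h)
  have e2 : d.pos γ c ≠ d.pos γ b := fun h => hcon.2 (d.pos_inj γ _ _ hc hb h)
  rcases Set.mem_uIcc.mp hs with ⟨h1, h2⟩ | ⟨h1, h2⟩
  · exact n1 ⟨lt_of_le_of_ne h1 e1.symm, lt_of_le_of_ne h2 e2⟩
  · exact n2 ⟨lt_of_le_of_ne h1 e2.symm, lt_of_le_of_ne h2 e1⟩

theorem edge_uniq (γ : Γ) (a b a' b' : V) (h : d.Edge γ a b) (h' : d.Edge γ a' b') (s : ℝ)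
    (h1 : d.pos γ a < s) (h2 : s < d.pos γ b) (h3 : d.pos γ a' < s) (h4 : s < d.pos γ b') :
    a = a' ∧ b = b' := by
  have x1 := (h.2.2.2 a' h'.1).1
  have x2 := (h.2.2.2 b' h'.2.1).1
  have x3 := (h'.2.2.2 a h.1).1
  have x4 := (h'.2.2.2 b h.2.1).1
  constructor
  · apply d.pos_inj γ _ _ h.1 h'.1
    by_contra hne
    rcases lt_or_gt_of_ne hne with hl | hl
    · exact x1 ⟨hl, by linarith⟩
    · exact x3 ⟨hl, by linarith⟩
  · apply d.pos_inj γ _ _ h.2.1 h'.2.1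
    by_contra hne
    rcases lt_or_gt_of_ne hne with hl | hl
    · exact x4 ⟨by linarith, hl⟩
    · exact x2 ⟨by linarith, hl⟩

theorem edge_uniq' (γ : Γ) (a b a' b' : V) (h : d.Edge γ a b) (h' : d.Edge γ a' b') (s : ℝ)
    (hs : s ∈ Set.uIcc (d.pos γ a) (d.pos γ b)) (hs' : s ∈ Set.uIcc (d.pos γ a') (d.pos γ b'))
    (n1 : s ≠ d.pos γ a) (n2 : s ≠ d.pos γ b) (n3 : s ≠ d.pos γ a') (n4 : s ≠ d.pos γ b')
    (ho : (d.pos γ a < d.pos γ b) ↔ (d.pos γ a' < d.pos γ b')) : a = a' ∧ b = b' := by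
  rcases Set.mem_uIcc.mp hs with ⟨h1, h2⟩ | ⟨h1, h2⟩
  · have l1 := lt_of_le_of_ne h1 n1.symm
    have l2 := lt_of_le_of_ne h2 n2
    have l3 := ho.mp (l1.trans l2)
    rw [Set.uIcc_of_le l3.le] at hs'
    exact d.edge_uniq γ a b a' b' h h' s l1 l2 (lt_of_le_of_ne hs'.1 n3.symm)
      (lt_of_le_of_ne hs'.2 n4)
  · have l1 := lt_of_le_of_ne h1 n2.symm
    have l2 := lt_of_le_of_ne h2 n1
    have l3 : ¬ (d.pos γ a' < d.pos γ b') := fun hh => absurd (ho.mpr hh) (by linarith)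
    rw [Set.uIcc_of_ge (not_lt.mp l3)] at hs'
    have := d.edge_uniq γ b a b' a' h.symm h'.symm s l1 l2 (lt_of_le_of_ne hs'.1 n4.symm)
      (lt_of_le_of_ne hs'.2 n3)
    exact ⟨this.2, this.1⟩

theorem cross_bound [Fintype Γ] (E : Finset (Γ × V × V)) (hE : ∀ e ∈ E, d.Edge e.1 e.2.1 e.2.2) :
    ((E ×ˢ E).filter (fun q => PSCross d.arc q.1 q.2)).card ≤ 4 * k * Fintype.card Γ ^ 2 := by
  set X := (E ×ˢ E).filter (fun q => PSCross d.arc q.1 q.2) with hX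
  have hI : ∀ w : Γ × Γ, ∃ I : Finset (ℝ × ℝ), I.card ≤ k ∧ (w.1 ≠ w.2 →
      ∀ s ∈ Set.Icc (0:ℝ) 1, ∀ t ∈ Set.Icc (0:ℝ) 1, d.g w.1 s = d.g w.2 t → d.g w.1 s ∈ I) := by
    intro w
    by_cases h : w.1 = w.2
    · exact ⟨∅, by simp, fun h' => absurd h h'⟩
    · obtain ⟨I, h1, h2⟩ := d.inter w.1 w.2 h
      exact ⟨I, h1, fun _ => h2⟩
  choose I hIc hI using hI
  have hz : ∀ q : (Γ × V × V) × (Γ × V × V), ∃ st : ℝ × ℝ, q ∈ X →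
      d.Edge q.1.1 q.1.2.1 q.1.2.2 ∧ d.Edge q.2.1 q.2.2.1 q.2.2.2 ∧ q.1.1 ≠ q.2.1 ∧
      st.1 ∈ Set.uIcc (d.pos q.1.1 q.1.2.1) (d.pos q.1.1 q.1.2.2) ∧
      st.2 ∈ Set.uIcc (d.pos q.2.1 q.2.2.1) (d.pos q.2.1 q.2.2.2) ∧
      d.g q.1.1 st.1 = d.g q.2.1 st.2 ∧
      st.1 ≠ d.pos q.1.1 q.1.2.1 ∧ st.1 ≠ d.pos q.1.1 q.1.2.2 ∧
      st.2 ≠ d.pos q.2.1 q.2.2.1 ∧ st.2 ≠ d.pos q.2.1 q.2.2.2 := by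
    rintro ⟨⟨γ, a, b⟩, ⟨γ', x, y⟩⟩
    by_cases hq : ((γ, a, b), (γ', x, y)) ∈ X
    swap
    · exact ⟨0, fun h => absurd h hq⟩
    rw [hX, Finset.mem_filter, Finset.mem_product] at hq
    obtain ⟨⟨he, he'⟩, n1, n2, n3, n4, hx⟩ := hq
    simp only at he he' n1 n2 n3 n4 hx
    have e1 := hE _ he
    have e2 := hE _ he'
    simp only at e1 e2
    rw [Set.not_disjoint_iff] at hx
    obtain ⟨z, ⟨s, hs, hsz⟩, ⟨t, ht, htz⟩⟩ := hx
    have hs01 := d.uIcc_sub γ a b e1.1 e1.2.1 hs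
    have ht01 := d.uIcc_sub γ' x y e2.1 e2.2.1 ht
    have heq : d.g γ s = d.g γ' t := hsz.trans htz.symm
    -- a vertex cannot be the intersection
    have nov : ∀ v, d.p v = d.g γ s → False := by
      intro v hv
      have o1 := d.on_of γ v s hs01 hv.symm
      have o2 := d.on_of γ' v t ht01 (heq.symm.trans hv.symm)
      have p1 : s = d.pos γ v := d.g_inj γ hs01 (d.pos_mem γ v o1) (by rw [d.g_pos γ v o1, hv])
      have p2 : t = d.pos γ' v := d.g_inj γ' ht01 (d.pos_mem γ' v o2)
        (by rw [d.g_pos γ' v o2, hv, heq])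
      rw [p1] at hs
      rw [p2] at ht
      rcases d.edge_vertex γ a b v e1 o1 hs with rfl | rfl <;>
        rcases d.edge_vertex γ' x y v e2 o2 ht with rfl | rfl <;> contradiction
    have s1 : s ≠ d.pos γ a := fun h => nov a (by rw [h, d.g_pos γ a e1.1])
    have s2 : s ≠ d.pos γ b := fun h => nov b (by rw [h, d.g_pos γ b e1.2.1])
    have t1 : t ≠ d.pos γ' x := fun h => nov x (by rw [heq, h, d.g_pos γ' x e2.1])
    have t2 : t ≠ d.pos γ' y := fun h => nov y (by rw [heq, h, d.g_pos γ' y e2.2.1])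
    have hne : γ ≠ γ' := by
      rintro rfl
      have hst : s = t := d.g_inj γ hs01 ht01 heq
      subst hst
      by_cases ho : (d.pos γ a < d.pos γ b) ↔ (d.pos γ x < d.pos γ y)
      · exact n1 (d.edge_uniq' γ a b x y e1 e2 s hs ht s1 s2 t1 t2 ho).1
      · refine n2 (d.edge_uniq' γ a b y x e1 e2.symm s hs (by rwa [Set.uIcc_comm]) s1 s2 t2 t1 ?_).1
        have : d.pos γ x ≠ d.pos γ y := fun h => e2.2.2.1 (d.pos_inj γ _ _ e2.1 e2.2.1 h)
        constructor
        · intro h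
          by_contra h'
          exact ho ⟨fun _ => lt_of_le_of_ne (not_lt.mp h') this, fun _ => h⟩
        · intro h
          by_contra h'
          exact ho ⟨fun h'' => absurd h'' h', fun h'' => absurd h (not_lt.mpr h''.le)⟩
    exact ⟨(s, t), fun _ => ⟨e1, e2, hne, hs, ht, heq, s1, s2, t1, t2⟩⟩
  choose st hst using hz
  let Y : Finset ((Σ _ : Γ × Γ, ℝ × ℝ) × (Prop × Prop)) :=
    ((Finset.univ : Finset (Γ × Γ)).sigma I) ×ˢ Finset.univ
  have hY : Y.card ≤ 4 * k * Fintype.card Γ ^ 2 := by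
    simp only [Y, Finset.card_product, Finset.card_sigma, Finset.card_univ, Fintype.card_prod,
      Fintype.card_prop]
    calc _ ≤ (∑ _w : Γ × Γ, k) * (2 * 2) := by gcongr with w; exact hIc w
      _ = _ := by simp [Fintype.card_prod]; ring
  refine le_trans (Finset.card_le_card_of_injOn (t := Y) (fun q => (⟨(q.1.1, q.2.1), d.g q.1.1 (st q).1⟩,
    (d.pos q.1.1 q.1.2.1 < d.pos q.1.1 q.1.2.2),
    (d.pos q.2.1 q.2.2.1 < d.pos q.2.1 q.2.2.2))) ?_ ?_) hY
  · intro q hq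
    obtain ⟨e1, e2, hne, hs, ht, heq, -⟩ := hst q hq
    simp only [Y, Finset.coe_product, Set.mem_prod, Finset.coe_univ, Set.mem_univ, and_true,
      Finset.mem_coe, Finset.mem_sigma, Finset.mem_univ, true_and]
    exact hI (q.1.1, q.2.1) hne _ (d.uIcc_sub _ _ _ e1.1 e1.2.1 hs) _
      (d.uIcc_sub _ _ _ e2.1 e2.2.1 ht) heq
  · intro q hq q' hq' hqq
    have A1 := hst q hq
    have A2 := hst q' hq'
    obtain ⟨⟨γ, a, b⟩, ⟨δ, x, y⟩⟩ := q
    obtain ⟨⟨γ', a', b'⟩, ⟨δ', x', y'⟩⟩ := q'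
    simp only [Prod.mk.injEq, Sigma.mk.injEq] at hqq
    simp only at A1 A2
    obtain ⟨⟨⟨rfl, rfl⟩, hz⟩, ho1, ho2⟩ := hqq
    rw [heq_eq_eq] at hz
    obtain ⟨e1, e2, hne, hs, ht, heq, s1, s2, t1, t2⟩ := A1
    obtain ⟨e1', e2', hne', hs', ht', heq', s1', s2', t1', t2'⟩ := A2
    have q1 := d.g_inj γ (d.uIcc_sub _ _ _ e1.1 e1.2.1 hs) (d.uIcc_sub _ _ _ e1'.1 e1'.2.1 hs') hz
    have q2 := d.g_inj δ (d.uIcc_sub _ _ _ e2.1 e2.2.1 ht) (d.uIcc_sub _ _ _ e2'.1 e2'.2.1 ht')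
      (by rw [← heq, ← heq', hz])
    rw [← q1] at hs' s1' s2'
    rw [← q2] at ht' t1' t2'
    obtain ⟨rfl, rfl⟩ := d.edge_uniq' γ a b a' b' e1 e1' _ hs hs' s1 s2 s1' s2' (by rw [ho1])
    obtain ⟨rfl, rfl⟩ := d.edge_uniq' δ x y x' y' e2 e2' _ ht ht' t1 t2 t1' t2' (by rw [ho2])
    rfl

theorem degree_bound [Fintype V] [Fintype Γ] (a : V) :
    (Finset.univ.filter (fun q : Γ × V => d.Edge q.1 a q.2)).card ≤
      2 * (Finset.univ.filter (fun γ => d.on γ a)).card := by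
  have : ((Finset.univ.filter (fun γ => d.on γ a)) ×ˢ (Finset.univ : Finset Prop)).card
      = 2 * (Finset.univ.filter (fun γ => d.on γ a)).card := by
    rw [Finset.card_product, Finset.card_univ, Fintype.card_prop, mul_comm]
  rw [← this]
  refine Finset.card_le_card_of_injOn (fun q => (q.1, (d.pos q.1 a < d.pos q.1 q.2))) ?_ ?_
  · intro q hq
    have hq : d.Edge q.1 a q.2 := by simpa using hq
    simp [hq.1]
    exact lt_or_ge _ _
  · rintro ⟨γ, b⟩ hq ⟨γ', b'⟩ hq' hqq
    have hq : d.Edge γ a b := by simpa using hq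
    have hq' : d.Edge γ' a b' := by simpa using hq'
    simp only [Prod.mk.injEq] at hqq
    obtain ⟨rfl, ho⟩ := hqq
    congr 1
    apply d.pos_inj γ _ _ hq.2.1 hq'.2.1
    by_contra hne
    have na : d.pos γ b ≠ d.pos γ a := fun h => hq.2.2.1 (d.pos_inj γ _ _ hq.2.1 hq.1 h).symm
    have na' : d.pos γ b' ≠ d.pos γ a := fun h => hq'.2.2.1 (d.pos_inj γ _ _ hq'.2.1 hq'.1 h).symm
    have x1 := hq.2.2.2 b' hq'.2.1
    have x2 := hq'.2.2.2 b hq.2.1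
    rcases lt_or_gt_of_ne na with l | l
    · have l' : d.pos γ b' < d.pos γ a := by
        refine lt_of_le_of_ne (not_lt.mp ?_) na'
        rw [← ho]; exact not_lt.mpr l.le
      rcases lt_or_gt_of_ne hne with h | h
      · exact x1.2 ⟨h, l'⟩
      · exact x2.2 ⟨h, l⟩
    · have l' : d.pos γ a < d.pos γ b' := by rw [← ho]; exact l
      rcases lt_or_gt_of_ne hne with h | h
      · exact x2.1 ⟨l, h⟩
      · exact x1.1 ⟨l', h⟩

theorem exists_seq [Fintype V] [Nonempty V] (γ : Γ) : ∃ x : ℕ → V,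
    (∀ i < (Finset.univ.filter (d.on γ)).card, d.on γ (x i)) ∧
    (∀ i j, i < j → j < (Finset.univ.filter (d.on γ)).card → d.pos γ (x i) < d.pos γ (x j)) ∧
    ∀ v, d.on γ v → ∃ i < (Finset.univ.filter (d.on γ)).card, x i = v := by
  set S := Finset.univ.filter (d.on γ) with hS
  have hSm : ∀ v, v ∈ S ↔ d.on γ v := by simp [hS]
  have hc : (S.image (d.pos γ)).card = S.card := by
    apply Finset.card_image_of_injOn
    intro a ha b hb h
    exact d.pos_inj γ a b ((hSm a).mp ha) ((hSm b).mp hb) h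
  let e := (S.image (d.pos γ)).orderEmbOfFin hc
  have he : ∀ i, ∃ v, d.on γ v ∧ d.pos γ v = e i := by
    intro i
    obtain ⟨v, hv, h⟩ := Finset.mem_image.mp (Finset.orderEmbOfFin_mem _ hc i)
    exact ⟨v, (hSm v).mp hv, h⟩
  choose y hy hye using he
  refine ⟨fun i => if h : i < S.card then y ⟨i, h⟩ else Classical.arbitrary V, ?_, ?_, ?_⟩
  · intro i hi
    simp only [hi, dif_pos]
    exact hy _
  · intro i j hij hj
    simp only [hj, hij.trans hj, dif_pos, hye]
    exact e.strictMono hij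
  · intro v hv
    have : d.pos γ v ∈ Set.range e := by
      rw [Finset.range_orderEmbOfFin]
      exact Finset.mem_coe.mpr (Finset.mem_image_of_mem _ ((hSm v).mpr hv))
    obtain ⟨i, hi⟩ := this
    refine ⟨i, i.2, ?_⟩
    simp only [i.2, dif_pos]
    exact d.pos_inj γ _ _ (hy _) hv (by rw [hye]; exact hi)

end PSData

theorem ps_paths {V : Type*} [Fintype V] (H : V → V → Prop) (D : ℕ)
    (hD : ∀ a, (Finset.univ.filter (fun b => H a b)).card ≤ D) (k : ℕ) :
    (Finset.univ.filter (fun v : Fin (k + 1) → V =>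
      ∀ j : Fin k, H (v j.castSucc) (v j.succ))).card ≤ Fintype.card V * D ^ k := by
  induction k with
  | zero =>
    refine (Finset.card_filter_le _ _).trans ?_
    simp
  | succ k ih =>
    set T := Finset.univ.filter (fun v : Fin (k + 1) → V =>
      ∀ j : Fin k, H (v j.castSucc) (v j.succ)) with hT
    set T' := Finset.univ.filter (fun v : Fin (k + 1 + 1) → V =>
      ∀ j : Fin (k + 1), H (v j.castSucc) (v j.succ)) with hT'
    have h1 : T'.card ≤ D * (T'.image Fin.init).card := by
      apply Finset.card_le_mul_card_image
      intro w hw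
      refine le_trans (Finset.card_le_card_of_injOn (fun v => v (Fin.last _)) ?_ ?_)
        (hD (w (Fin.last k)))
      · intro v hv
        simp only [Finset.coe_filter, Set.mem_setOf_eq, hT', Finset.mem_filter, Finset.mem_univ,
          true_and] at hv ⊢
        obtain ⟨h, rfl⟩ := hv
        exact h (Fin.last k)
      · intro v hv v' hv' h
        simp only [Finset.coe_filter, Set.mem_setOf_eq] at hv hv'
        rw [← Fin.snoc_init_self v, ← Fin.snoc_init_self v', hv.2, hv'.2]
        simp only at h
        rw [h]
    have h2 : T'.image Fin.init ⊆ T := by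
      intro w hw
      obtain ⟨v, hv, rfl⟩ := Finset.mem_image.mp hw
      simp only [hT, hT', Finset.mem_filter, Finset.mem_univ, true_and] at hv ⊢
      intro j
      exact hv j.castSucc
    calc T'.card ≤ D * T.card := h1.trans (Nat.mul_le_mul_left _ (Finset.card_le_card h2))
      _ ≤ D * (Fintype.card V * D ^ k) := Nat.mul_le_mul_left _ ih
      _ = _ := by ring



namespace PSData

variable {V Γ : Type*} {k : ℕ} (d : PSData V Γ k)

/-- Multiplicity of a pair. -/
noncomputable def mult [Fintype Γ] (a b : V) : ℕ :=
  (Finset.univ.filter (fun γ => d.Edge γ a b)).card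

/-- The edges of small multiplicity. -/
noncomputable def low [Fintype V] [Fintype Γ] (M : ℕ) : Finset (Γ × V × V) :=
  Finset.univ.filter (fun e => d.Edge e.1 e.2.1 e.2.2 ∧ d.mult e.2.1 e.2.2 ≤ M)

theorem eq_of_common (γ γ' : Γ) (v : Fin (k + 1) → V) (hv : Function.Injective v)
    (h1 : ∀ j, d.on γ (v j)) (h2 : ∀ j, d.on γ' (v j)) : γ = γ' := by
  by_contra hne
  obtain ⟨I, hI, hI'⟩ := d.inter γ γ' hne
  have : (Finset.univ.image (fun j => d.p (v j))) ⊆ I := by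
    intro z hz
    obtain ⟨j, -, rfl⟩ := Finset.mem_image.mp hz
    have := hI' _ (d.pos_mem γ _ (h1 j)) _ (d.pos_mem γ' _ (h2 j))
      (by rw [d.g_pos γ _ (h1 j), d.g_pos γ' _ (h2 j)])
    rwa [d.g_pos γ _ (h1 j)] at this
  have h3 := Finset.card_le_card this
  rw [Finset.card_image_of_injective _ (fun a b h => hv (d.p_inj h))] at h3
  simp at h3
  omega

theorem decomp [Fintype V] [Nonempty V] [Fintype Γ] (M D : ℕ)
    (hD : ∀ a, (Finset.univ.filter (fun b => M < d.mult a b)).card ≤ D) :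
    ∑ γ, (Finset.univ.filter (d.on γ)).card ≤
      k * Fintype.card Γ + k * (d.low M).card + Fintype.card V * D ^ k := by
  choose x hx1 hx2 hx3 using d.exists_seq
  set r : Γ → ℕ := fun γ => (Finset.univ.filter (d.on γ)).card with hr
  have xinj : ∀ γ i j, i < r γ → j < r γ → x γ i = x γ j → i = j := by
    intro γ i j hi hj h
    by_contra hne
    rcases lt_or_gt_of_ne hne with l | l
    · have := hx2 γ i j l hj; rw [h] at this; exact lt_irrefl _ this
    · have := hx2 γ j i l hi; rw [h] at this; exact lt_irrefl _ this
  have hedge : ∀ γ i, i + 1 < r γ → d.Edge γ (x γ i) (x γ (i + 1)) := by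
    intro γ i hi
    have key := hx2 γ i (i + 1) (Nat.lt_succ_self i) hi
    refine ⟨hx1 γ i (show i < r γ by omega), hx1 γ (i + 1) hi, ?_, ?_⟩
    · intro h; rw [← h] at key; exact lt_irrefl _ key
    · intro c hc
      obtain ⟨j, hj, rfl⟩ := hx3 γ c hc
      have mono : ∀ a b, a < r γ → b < r γ → d.pos γ (x γ a) < d.pos γ (x γ b) → a < b := by
        intro a b ha hb hab
        by_contra hcon
        rcases Nat.lt_or_eq_of_le (not_lt.mp hcon) with l | l
        · exact absurd (hx2 γ b a l ha) (not_lt.mpr hab.le)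
        · subst l; exact lt_irrefl _ hab
      constructor
      · rintro ⟨h1, h2⟩
        have := mono _ _ (by omega) hj h1
        have := mono _ _ hj hi h2
        omega
      · rintro ⟨h1, h2⟩
        exact absurd (h1.trans h2) (not_lt.mpr key.le)
  set S : Finset (Σ _ : Γ, ℕ) := Finset.univ.sigma (fun γ => Finset.range (r γ)) with hS
  have hSc : S.card = ∑ γ, r γ := by simp [hS]
  have hmS : ∀ q, q ∈ S ↔ q.2 < r q.1 := by intro q; simp [hS]
  rw [← hSc]
  set Z1 := S.filter (fun q => r q.1 ≤ q.2 + k) with hZ1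
  set Z2 := S.filter (fun q => ∃ j < k, q.2 + j + 1 < r q.1 ∧
    (q.1, x q.1 (q.2 + j), x q.1 (q.2 + j + 1)) ∈ d.low M) with hZ2
  set Z3 := S.filter (fun q => q.2 + k < r q.1 ∧ ∀ j < k,
    M < d.mult (x q.1 (q.2 + j)) (x q.1 (q.2 + j + 1))) with hZ3
  have hsub : S ⊆ Z1 ∪ Z2 ∪ Z3 := by
    intro q hq
    simp only [Finset.mem_union, hZ1, hZ2, hZ3, Finset.mem_filter, hq, true_and]
    by_cases h1 : r q.1 ≤ q.2 + k
    · exact Or.inl (Or.inl h1)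
    by_cases h2 : ∃ j < k, d.mult (x q.1 (q.2 + j)) (x q.1 (q.2 + j + 1)) ≤ M
    · obtain ⟨j, hj, h⟩ := h2
      refine Or.inl (Or.inr ⟨j, hj, by omega, ?_⟩)
      simp only [low, Finset.mem_filter, Finset.mem_univ, true_and]
      exact ⟨hedge _ _ (by omega), h⟩
    · push Not at h2
      exact Or.inr ⟨by omega, h2⟩
  have c1 : Z1.card ≤ k * Fintype.card Γ := by
    have : ((Finset.range k) ×ˢ (Finset.univ : Finset Γ)).card = k * Fintype.card Γ := by simp
    rw [← this]
    refine Finset.card_le_card_of_injOn (fun q => (r q.1 - 1 - q.2, q.1)) ?_ ?_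
    · intro q hq
      have hq := Finset.mem_filter.mp hq
      have := (hmS q).mp hq.1
      simp
      omega
    · rintro ⟨γ, i⟩ hq ⟨γ', i'⟩ hq' h
      have hq := (hmS _).mp (Finset.mem_filter.mp hq).1
      have hq' := (hmS _).mp (Finset.mem_filter.mp hq').1
      simp only [Prod.mk.injEq] at h hq hq'
      obtain ⟨h, rfl⟩ := h
      have : i = i' := by omega
      rw [this]
  have c2 : Z2.card ≤ k * (d.low M).card := by
    have hj : ∀ q : (Σ _ : Γ, ℕ), ∃ j, q ∈ Z2 → j < k ∧ q.2 + j + 1 < r q.1 ∧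
        (q.1, x q.1 (q.2 + j), x q.1 (q.2 + j + 1)) ∈ d.low M := by
      intro q
      by_cases hq : q ∈ Z2
      · obtain ⟨j, hj⟩ := (Finset.mem_filter.mp hq).2
        exact ⟨j, fun _ => hj⟩
      · exact ⟨0, fun h => absurd h hq⟩
    choose J hJ using hj
    have : ((Finset.range k) ×ˢ (d.low M)).card = k * (d.low M).card := by simp
    rw [← this]
    refine Finset.card_le_card_of_injOn
      (fun q => (J q, (q.1, x q.1 (q.2 + J q), x q.1 (q.2 + J q + 1)))) ?_ ?_
    · intro q hq
      have := hJ q hq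
      simp only [Finset.coe_product, Set.mem_prod, Finset.mem_coe, Finset.mem_range]
      exact ⟨this.1, this.2.2⟩
    · intro q hq q' hq' h
      have a1 := hJ q hq
      have a2 := hJ q' hq'
      obtain ⟨γ, i⟩ := q
      obtain ⟨γ', i'⟩ := q'
      simp only [Prod.mk.injEq] at h a1 a2
      obtain ⟨h1, rfl, h2, -⟩ := h
      rw [← h1] at h2 a2
      have := xinj γ _ _ (by omega) (by omega) h2
      have : i = i' := by omega
      rw [this]
  have c3 : Z3.card ≤ Fintype.card V * D ^ k := by
    refine le_trans (Finset.card_le_card_of_injOn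
      (fun q => (fun j : Fin (k + 1) => x q.1 (q.2 + j))) ?_ ?_)
      (ps_paths (fun a b => M < d.mult a b) D (fun a => by convert hD a) k)
    · intro q hq
      have hq := (Finset.mem_filter.mp hq).2
      simp only [Finset.mem_coe, Finset.mem_filter, Finset.mem_univ, true_and]
      intro j
      exact hq.2 j j.2
    · rintro ⟨γ, i⟩ hq ⟨γ', i'⟩ hq' h
      have hq := (Finset.mem_filter.mp hq).2
      have hq' := (Finset.mem_filter.mp hq').2
      simp only at h hq hq'
      have e : ∀ j : Fin (k + 1), x γ (i + j) = x γ' (i' + j) := fun j => congrFun h j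
      have : γ = γ' := by
        apply d.eq_of_common γ γ' (fun j => x γ (i + j))
        · intro a b hab
          have := xinj γ _ _ (by omega) (by omega) hab
          ext; omega
        · intro j; exact hx1 γ _ (show _ < r γ by omega)
        · intro j; simp only [e]; exact hx1 γ' _ (show _ < r γ' by omega)
      subst this
      have := xinj γ _ _ (by omega) (by omega) (e 0)
      simp at this
      rw [this]
  calc S.card ≤ (Z1 ∪ Z2 ∪ Z3).card := Finset.card_le_card hsub
    _ ≤ (Z1 ∪ Z2).card + Z3.card := Finset.card_union_le _ _
    _ ≤ Z1.card + Z2.card + Z3.card := by gcongr; exact Finset.card_union_le _ _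
    _ ≤ _ := by gcongr

end PSData



/-- The numerical constant used in the class lemma. -/
def psB (k : ℕ) : ℕ := k * (5 * 4 ^ 10) * 2 ^ (k + 4)

theorem ps_arith (k K n m L M t X Dk : ℕ) (hX : 4 * k * K * M * t = X) (hD : 2 * Dk ≤ X)
    (h1 : m * X ≤ k * n + k * L + m * Dk)
    (h2 : L * M * t ^ 2 ≤ K * m * M ^ 2 * t ^ 3 + 4 * k * n ^ 2) :
    m * X * (M * t ^ 2) ≤ 4 * k * n * (M * t ^ 2) + 16 * k ^ 2 * n ^ 2 := by
  have a1 : m * X ≤ 2 * k * n + 2 * k * L := by nlinarith [Nat.mul_le_mul_left m hD]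
  have a2 := Nat.mul_le_mul_right (M * t ^ 2) a1
  have a3 := Nat.mul_le_mul_left (2 * k) h2
  have a4 : 4 * (k * (K * m * M ^ 2 * t ^ 3)) = m * X * (M * t ^ 2) := by rw [← hX]; ring
  nlinarith

namespace PSData

variable {V Γ : Type*} {k : ℕ} (d : PSData V Γ k)

theorem mult_symm [Fintype Γ] (a b : V) : d.mult a b = d.mult b a := by
  unfold mult
  congr 1
  ext γ
  simp only [Finset.mem_filter, Finset.mem_univ, true_and]
  exact ⟨Edge.symm, Edge.symm⟩

theorem low_bound [Fintype V] [Fintype Γ] (M t : ℕ) (hM : 1 ≤ M) (ht : 1 ≤ t) :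
    (d.low M).card * M * t ^ 2 ≤
      5 * 4 ^ 10 * Fintype.card V * M ^ 2 * t ^ 3 + 4 * k * Fintype.card Γ ^ 2 := by
  have hl : ∀ γ a b, (γ, a, b) ∈ d.low M ↔ d.Edge γ a b ∧ d.mult a b ≤ M := by
    intro γ a b; simp [low]
  refine (ps_crossing d.p d.arc d.arc_symm (d.low M) ?_ ?_ ?_ M t hM ht ?_).trans ?_
  · intro γ a b h
    rw [hl] at h ⊢
    exact ⟨h.1.symm, by rw [d.mult_symm]; exact h.2⟩
  · intro γ a b h
    exact ((hl _ _ _).mp h).1.2.2.1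
  · intro γ a b h
    exact d.joined γ a b ((hl _ _ _).mp h).1
  · intro a b
    by_cases h : d.mult a b ≤ M
    · refine le_trans (Finset.card_le_card ?_) h
      intro γ hγ
      simp only [Finset.mem_filter, Finset.mem_univ, true_and, hl] at hγ ⊢
      exact hγ.1
    · simp [hl, h]
  · gcongr
    exact d.cross_bound _ (fun e he => ((hl e.1 e.2.1 e.2.2).mp he).1)

theorem high_degree [Fintype V] [Fintype Γ] (M : ℕ) (a : V) :
    (Finset.univ.filter (fun b => M < d.mult a b)).card * M ≤
      2 * (Finset.univ.filter (fun γ => d.on γ a)).card := by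
  refine le_trans ?_ (d.degree_bound a)
  calc _ ≤ ∑ b ∈ Finset.univ.filter (fun b => M < d.mult a b), d.mult a b := by
        rw [← smul_eq_mul]
        apply Finset.card_nsmul_le_sum
        intro b hb
        exact (Finset.mem_filter.mp hb).2.le
    _ ≤ ∑ b, d.mult a b := Finset.sum_le_sum_of_subset (Finset.filter_subset _ _)
    _ = _ := by
        unfold mult
        simp only [Finset.card_filter]
        rw [Fintype.sum_prod_type, Finset.sum_comm]

theorem cls [Fintype V] [Fintype Γ] (hk : 1 ≤ k) (t : ℕ) (ht : 1 ≤ t)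
    (h1 : ∀ v, (psB k * t) ^ k ≤ (Finset.univ.filter (fun γ => d.on γ v)).card)
    (h2 : ∀ v, (Finset.univ.filter (fun γ => d.on γ v)).card ≤ (2 * (psB k * t)) ^ k) :
    Fintype.card V * (psB k * t) ^ k * t ^ (k + 1) ≤
      4 * k * Fintype.card Γ * t ^ (k + 1) + 16 * k ^ 2 * Fintype.card Γ ^ 2 := by
  rcases isEmpty_or_nonempty V with hV | hV
  · simp
  set s := psB k * t with hs
  have hB : 1 ≤ psB k := by unfold psB; exact Nat.mul_pos (by omega) (by positivity)
  have hst : t ≤ s := by rw [hs]; exact Nat.le_mul_of_pos_left t hB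
  have hs1 : 1 ≤ s := ht.trans hst
  set M := 2 ^ (k + 2) * s ^ (k - 1) with hM
  have hM1 : 1 ≤ M := Nat.mul_pos (by positivity) (by positivity)
  have hsk : s ^ k = s ^ (k - 1) * s := by rw [← pow_succ]; congr 1; omega
  have hDeg : ∀ a, (Finset.univ.filter (fun b => M < d.mult a b)).card ≤ s / 2 := by
    intro a
    have q := (d.high_degree M a).trans (Nat.mul_le_mul_left 2 (h2 a))
    set D := (Finset.univ.filter (fun b => M < d.mult a b)).card
    rw [mul_pow, hsk, hM] at q
    have q' : (2 * D) * (2 ^ (k + 1) * s ^ (k - 1)) ≤ s * (2 ^ (k + 1) * s ^ (k - 1)) := by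
      calc _ = D * (2 ^ (k + 2) * s ^ (k - 1)) := by ring
        _ ≤ _ := q
        _ = _ := by ring
    have := Nat.le_of_mul_le_mul_right q' (by positivity)
    omega
  have hdec := d.decomp M (s / 2) hDeg
  have hlow := d.low_bound M t hM1 ht
  have hsum : Fintype.card V * s ^ k ≤ ∑ γ, (Finset.univ.filter (d.on γ)).card := by
    have e : ∑ γ, (Finset.univ.filter (d.on γ)).card
        = ∑ v, (Finset.univ.filter (fun γ => d.on γ v)).card := by
      simp only [Finset.card_filter]
      exact Finset.sum_comm
    rw [e, ← smul_eq_mul]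
    exact Finset.card_nsmul_le_sum _ _ _ (fun v _ => h1 v)
  have hDk : 2 * (s / 2) ^ k ≤ s ^ k := by
    calc 2 * (s / 2) ^ k ≤ 2 ^ k * (s / 2) ^ k := by
          gcongr
          calc 2 = 2 ^ 1 := rfl
            _ ≤ 2 ^ k := Nat.pow_le_pow_right (by norm_num) hk
      _ = (2 * (s / 2)) ^ k := (mul_pow _ _ _).symm
      _ ≤ s ^ k := Nat.pow_le_pow_left (by omega) k
  have hX : 4 * k * (5 * 4 ^ 10) * M * t = s ^ k := by
    rw [hsk, hM]
    have : s = k * (5 * 4 ^ 10) * 2 ^ (k + 4) * t := hs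
    calc _ = s ^ (k - 1) * (k * (5 * 4 ^ 10) * 2 ^ (k + 4) * t) := by ring
      _ = _ := by rw [← this]
  have key := ps_arith k (5 * 4 ^ 10) (Fintype.card Γ) (Fintype.card V) (d.low M).card M t (s ^ k)
    ((s / 2) ^ k) hX hDk (hsum.trans hdec) hlow
  have hMt : t ^ (k + 1) ≤ M * t ^ 2 := by
    calc t ^ (k + 1) = t ^ (k - 1) * t ^ 2 := by rw [← pow_add]; congr 1; omega
      _ ≤ M * t ^ 2 := by
        gcongr
        calc t ^ (k - 1) ≤ s ^ (k - 1) := Nat.pow_le_pow_left hst _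
          _ ≤ M := Nat.le_mul_of_pos_left _ (by positivity)
  by_cases hc : Fintype.card V * s ^ k ≤ 4 * k * Fintype.card Γ
  · exact (Nat.mul_le_mul_right _ hc).trans (Nat.le_add_right _ _)
  · push Not at hc
    obtain ⟨c, hc⟩ := Nat.exists_eq_add_of_lt hc
    rw [hc] at key ⊢
    have := Nat.mul_le_mul_left (c + 1) hMt
    nlinarith

end PSData



theorem ps_sum_biUnion_le {α : Type*} [DecidableEq α] (s : Finset ℕ) (t : ℕ → Finset α) (f : α → ℕ) :
    ∑ x ∈ s.biUnion t, f x ≤ ∑ j ∈ s, ∑ x ∈ t j, f x := by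
  induction s using Finset.induction_on with
  | empty => simp
  | insert a s ha ih =>
    rw [Finset.biUnion_insert, Finset.sum_insert ha]
    refine le_trans ?_ (Nat.add_le_add_left ih _)
    rw [← Finset.sum_union_inter]
    exact Nat.le_add_right _ _

theorem ps_class (k : ℕ) (hk : 1 ≤ k) (Q : Finset (ℝ × ℝ)) (C : Finset (Set (ℝ × ℝ)))
    (hC : KIntersecting C k) (t : ℕ) (ht : 1 ≤ t)
    (h1 : ∀ x ∈ Q, (psB k * t) ^ k ≤ (C.filter (fun γ => x ∈ γ)).card)
    (h2 : ∀ x ∈ Q, (C.filter (fun γ => x ∈ γ)).card ≤ (2 * (psB k * t)) ^ k) :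
    Q.card * (psB k * t) ^ k * t ^ (k + 1) ≤
      4 * k * C.card * t ^ (k + 1) + 16 * k ^ 2 * C.card ^ 2 := by
  obtain ⟨hs, hi⟩ := hC
  choose f fc fi ff using fun γ : {γ // γ ∈ C} => hs γ.1 γ.2
  have hmem : ∀ (γ : {γ // γ ∈ C}) (s : ℝ) (_ : s ∈ Set.Icc (0:ℝ) 1),
      Set.IccExtend zero_le_one (f γ) s ∈ γ.1 := by
    intro γ s hs
    rw [ff γ]
    exact ⟨_, rfl⟩
  have hpos : ∀ (γ : {γ // γ ∈ C}) (v : {x // x ∈ Q}), ∃ s : ℝ, v.1 ∈ γ.1 →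
      s ∈ Set.Icc (0:ℝ) 1 ∧ Set.IccExtend zero_le_one (f γ) s = v.1 := by
    intro γ v
    by_cases h : v.1 ∈ γ.1
    · rw [ff γ] at h
      obtain ⟨s, hs⟩ := h
      refine ⟨s.1, fun _ => ⟨s.2, ?_⟩⟩
      rw [Set.IccExtend_of_mem _ _ s.2]
      exact hs
    · exact ⟨0, fun h' => absurd h' h⟩
  choose pos hpos using hpos
  let d : PSData {x // x ∈ Q} {γ // γ ∈ C} k :=
    { p := Subtype.val
      p_inj := Subtype.val_injective
      g := fun γ => Set.IccExtend zero_le_one (f γ)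
      g_cont := fun γ => (fc γ).Icc_extend'
      g_inj := by
        intro γ a ha b hb hab
        rw [Set.IccExtend_of_mem _ _ ha, Set.IccExtend_of_mem _ _ hb] at hab
        exact congrArg Subtype.val (fi γ hab)
      on := fun γ v => v.1 ∈ γ.1
      pos := pos
      pos_mem := fun γ v h => (hpos γ v h).1
      g_pos := fun γ v h => (hpos γ v h).2
      on_of := by
        intro γ v s hs h
        rw [← h]
        exact hmem γ s hs
      inter := by
        intro γ γ' hne
        obtain ⟨hf, hc⟩ := hi γ.1 γ.2 γ'.1 γ'.2 (fun h => hne (Subtype.ext h))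
        refine ⟨hf.toFinset, by rwa [← Set.ncard_eq_toFinset_card _ hf], ?_⟩
        intro s hs t ht h
        rw [Set.Finite.mem_toFinset]
        exact ⟨hmem γ s hs, by rw [h]; exact hmem γ' t ht⟩ }
  have hrho : ∀ v : {x // x ∈ Q}, (Finset.univ.filter (fun γ => d.on γ v)).card
      = (C.filter (fun γ => v.1 ∈ γ)).card := by
    intro v
    have : (C.filter (fun γ => v.1 ∈ γ))
        = (Finset.univ.filter (fun γ : {γ // γ ∈ C} => d.on γ v)).map
          (Function.Embedding.subtype _) := by
      ext γ
      simp [d, and_comm]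
    rw [this, Finset.card_map]
  have := d.cls hk t ht (fun v => by rw [hrho]; exact h1 v.1 v.2)
    (fun v => by rw [hrho]; exact h2 v.1 v.2)
  simpa using this

theorem ps_class_real (k : ℕ) (hk : 1 ≤ k) (Q : Finset (ℝ × ℝ)) (C : Finset (Set (ℝ × ℝ)))
    (hC : KIntersecting C k) (N j : ℕ) (hN : 1 ≤ N) (hn : C.card ≤ N ^ (2 * k + 1))
    (h1 : ∀ x ∈ Q, (psB k * (2 ^ j * N)) ^ k ≤ (C.filter (fun γ => x ∈ γ)).card)
    (h2 : ∀ x ∈ Q, (C.filter (fun γ => x ∈ γ)).card ≤ (2 * (psB k * (2 ^ j * N))) ^ k) :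
    ((∑ x ∈ Q, (C.filter (fun γ => x ∈ γ)).card : ℕ) : ℝ) ≤
      2 ^ k * (4 * k * (N:ℝ) ^ (2 * k + 1) + 16 * k ^ 2 * (N:ℝ) ^ (3 * k + 1) * (1 / 2) ^ j) := by
  have hN' : (1:ℝ) ≤ N := by exact_mod_cast hN
  have key := ps_class k hk Q C hC (2 ^ j * N) (Nat.mul_pos (by positivity) hN) h1 h2
  have hsum : ∑ x ∈ Q, (C.filter (fun γ => x ∈ γ)).card ≤
      2 ^ k * (Q.card * (psB k * (2 ^ j * N)) ^ k) := by
    calc _ ≤ Q.card • (2 * (psB k * (2 ^ j * N))) ^ k := Finset.sum_le_card_nsmul _ _ _ h2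
      _ = _ := by rw [smul_eq_mul, mul_pow 2]; ring
  set S := Q.card * (psB k * (2 ^ j * N)) ^ k
  have hS : (S:ℝ) ≤ 4 * k * (N:ℝ) ^ (2 * k + 1)
      + 16 * k ^ 2 * (N:ℝ) ^ (3 * k + 1) * (1 / 2) ^ j := by
    have ht : (0:ℝ) < 2 ^ j * (N:ℝ) ^ (k + 1) := by positivity
    have ht2 : (2:ℝ) ^ j * (N:ℝ) ^ (k + 1) ≤ ((2 ^ j * N : ℕ) : ℝ) ^ (k + 1) := by
      push_cast
      rw [mul_pow]
      gcongr
      exact le_self_pow₀ (one_le_pow₀ (by norm_num)) (by omega)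
    have hT : (0:ℝ) < ((2 ^ j * N : ℕ) : ℝ) ^ (k + 1) := lt_of_lt_of_le ht ht2
    have hc : (C.card : ℝ) ≤ (N:ℝ) ^ (2 * k + 1) := by exact_mod_cast hn
    have key' : (S:ℝ) * ((2 ^ j * N : ℕ) : ℝ) ^ (k + 1) ≤
        4 * k * C.card * ((2 ^ j * N : ℕ) : ℝ) ^ (k + 1) + 16 * k ^ 2 * (C.card:ℝ) ^ 2 := by
      exact_mod_cast key
    have e : (16 * k ^ 2 * (N:ℝ) ^ (3 * k + 1) * (1 / 2) ^ j) * (2 ^ j * (N:ℝ) ^ (k + 1))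
        = 16 * k ^ 2 * ((N:ℝ) ^ (2 * k + 1)) ^ 2 := by
      have : ((1:ℝ) / 2) ^ j * 2 ^ j = 1 := by rw [← mul_pow]; norm_num
      calc _ = 16 * (k:ℝ) ^ 2 * ((N:ℝ) ^ (3 * k + 1) * (N:ℝ) ^ (k + 1)) * ((1 / 2) ^ j * 2 ^ j) := by
            ring
        _ = _ := by rw [this]; ring
    refine le_of_mul_le_mul_right ?_ hT
    calc _ ≤ _ := key'
      _ ≤ 4 * k * (N:ℝ) ^ (2 * k + 1) * ((2 ^ j * N : ℕ) : ℝ) ^ (k + 1)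
          + 16 * k ^ 2 * ((N:ℝ) ^ (2 * k + 1)) ^ 2 := by gcongr
      _ = 4 * k * (N:ℝ) ^ (2 * k + 1) * ((2 ^ j * N : ℕ) : ℝ) ^ (k + 1) +
        (16 * k ^ 2 * (N:ℝ) ^ (3 * k + 1) * (1 / 2) ^ j) * (2 ^ j * (N:ℝ) ^ (k + 1)) := by rw [e]
      _ ≤ 4 * k * (N:ℝ) ^ (2 * k + 1) * ((2 ^ j * N : ℕ) : ℝ) ^ (k + 1) +
        (16 * k ^ 2 * (N:ℝ) ^ (3 * k + 1) * (1 / 2) ^ j) * ((2 ^ j * N : ℕ) : ℝ) ^ (k + 1) := by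
          gcongr
      _ = _ := by ring
  calc _ ≤ ((2 ^ k * S : ℕ) : ℝ) := by exact_mod_cast hsum
    _ = 2 ^ k * (S:ℝ) := by push_cast; ring
    _ ≤ _ := by gcongr

theorem ps_total (k : ℕ) (hk : 1 ≤ k) (P : Finset (ℝ × ℝ)) (C : Finset (Set (ℝ × ℝ)))
    (hC : KIntersecting C k) (N : ℕ) (hN : 1 ≤ N) (hP : P.card ≤ N ^ (2 * k + 1))
    (hn : C.card ≤ N ^ (2 * k + 1)) :
    (incidences P C : ℝ) ≤
      ((psB k : ℝ) ^ k + 2 ^ k * (4 * k * (2 * k + 2) + 32 * k ^ 2)) * (N:ℝ) ^ (3 * k + 1) := by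
  have hN' : (1:ℝ) ≤ N := by exact_mod_cast hN
  set ρ : ℝ × ℝ → ℕ := fun x => (C.filter (fun γ => x ∈ γ)).card with hρ
  have hI : incidences P C = ∑ x ∈ P, ρ x := by
    unfold incidences
    simp only [hρ, Finset.card_filter]
    exact Finset.sum_comm
  have hB : 1 ≤ psB k := by unfold psB; exact Nat.mul_pos (by omega) (by positivity)
  set J := (2 * k + 1) * N with hJ
  set P0 := P.filter (fun x => ρ x ≤ (psB k * N) ^ k) with hP0
  set Pj : ℕ → Finset (ℝ × ℝ) := fun j => P.filter (fun x =>
    (psB k * (2 ^ j * N)) ^ k ≤ ρ x ∧ ρ x ≤ (2 * (psB k * (2 ^ j * N))) ^ k) with hPj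
  have hcov : P ⊆ P0 ∪ (Finset.range (J + 1)).biUnion Pj := by
    intro x hx
    simp only [Finset.mem_union, Finset.mem_biUnion, Finset.mem_range, hP0, hPj,
      Finset.mem_filter, hx, true_and]
    by_cases h0 : ρ x ≤ (psB k * N) ^ k
    · exact Or.inl h0
    right
    have hex : ∃ j, ρ x ≤ (2 * (psB k * (2 ^ j * N))) ^ k ∧ j ≤ J := by
      refine ⟨J, ?_, le_rfl⟩
      calc ρ x ≤ C.card := Finset.card_filter_le _ _
        _ ≤ N ^ (2 * k + 1) := hn
        _ ≤ (2 ^ N) ^ (2 * k + 1) := Nat.pow_le_pow_left Nat.lt_two_pow_self.le _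
        _ = 2 ^ J := by rw [← pow_mul, hJ, mul_comm]
        _ ≤ 2 * (psB k * (2 ^ J * N)) := by
          have : 1 ≤ 2 * psB k * N := Nat.mul_pos (by omega) hN
          calc 2 ^ J ≤ 2 ^ J * (2 * psB k * N) := Nat.le_mul_of_pos_right _ this
            _ = _ := by ring
        _ ≤ _ := Nat.le_self_pow (by omega) _
    obtain ⟨hj1, hj2⟩ := Nat.find_spec hex
    have hmin := fun m => Nat.find_min (H := hex) (m := m)
    set j := Nat.find hex
    refine ⟨j, by omega, ?_, hj1⟩
    rcases Nat.eq_zero_or_pos j with hz | hz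
    · rw [hz, pow_zero, one_mul]; omega
    · have := hmin (j - 1) (by omega)
      rw [not_and_or] at this
      rcases this with h | h
      · have e : 2 * (psB k * (2 ^ (j - 1) * N)) = psB k * (2 ^ j * N) := by
          obtain ⟨i, hi⟩ : ∃ i, j = i + 1 := ⟨j - 1, by omega⟩
          rw [hi, Nat.add_sub_cancel, pow_succ]; ring
        rw [e] at h
        omega
      · omega
  have hsum : ∑ x ∈ P, ρ x ≤ ∑ x ∈ P0, ρ x + ∑ j ∈ Finset.range (J + 1), ∑ x ∈ Pj j, ρ x := by
    calc _ ≤ ∑ x ∈ P0 ∪ (Finset.range (J + 1)).biUnion Pj, ρ x :=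
          Finset.sum_le_sum_of_subset hcov
      _ ≤ ∑ x ∈ P0, ρ x + ∑ x ∈ (Finset.range (J + 1)).biUnion Pj, ρ x := by
          rw [← Finset.sum_union_inter]; exact Nat.le_add_right _ _
      _ ≤ _ := by
          gcongr
          exact ps_sum_biUnion_le _ _ _
  have hp0 : ((∑ x ∈ P0, ρ x : ℕ) : ℝ) ≤ (psB k : ℝ) ^ k * (N:ℝ) ^ (3 * k + 1) := by
    have : ∑ x ∈ P0, ρ x ≤ (psB k) ^ k * N ^ (3 * k + 1) := by
      calc _ ≤ P0.card • (psB k * N) ^ k :=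
            Finset.sum_le_card_nsmul _ _ _ (fun x hx => (Finset.mem_filter.mp hx).2)
        _ ≤ N ^ (2 * k + 1) * (psB k * N) ^ k := by
            rw [smul_eq_mul]
            gcongr
            exact (Finset.card_filter_le _ _).trans hP
        _ = _ := by rw [mul_pow]; ring
    exact_mod_cast this
  have hpj : ∀ j, ((∑ x ∈ Pj j, ρ x : ℕ) : ℝ) ≤
      2 ^ k * (4 * k * (N:ℝ) ^ (2 * k + 1) + 16 * k ^ 2 * (N:ℝ) ^ (3 * k + 1) * (1 / 2) ^ j) :=
    fun j => ps_class_real k hk (Pj j) C hC N j hN hn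
      (fun x hx => (Finset.mem_filter.mp hx).2.1) (fun x hx => (Finset.mem_filter.mp hx).2.2)
  have hgeo : ∑ j ∈ Finset.range (J + 1), ((1:ℝ) / 2) ^ j ≤ 2 := sum_geometric_two_le _
  have hJ' : ((J + 1 : ℕ) : ℝ) * (N:ℝ) ^ (2 * k + 1) ≤ (2 * k + 2) * (N:ℝ) ^ (3 * k + 1) := by
    calc _ ≤ ((2 * k + 2) * N) * (N:ℝ) ^ (2 * k + 1) := by
          gcongr
          rw [hJ]; push_cast; nlinarith
      _ = (2 * k + 2) * (N:ℝ) ^ (2 * k + 2) := by ring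
      _ ≤ _ := by
          gcongr ?_ * ?_
          exact pow_le_pow_right₀ hN' (by omega)
  rw [hI]
  calc ((∑ x ∈ P, ρ x : ℕ) : ℝ)
      ≤ ((∑ x ∈ P0, ρ x + ∑ j ∈ Finset.range (J + 1), ∑ x ∈ Pj j, ρ x : ℕ) : ℝ) := by
        exact_mod_cast hsum
    _ = ((∑ x ∈ P0, ρ x : ℕ) : ℝ) + ∑ j ∈ Finset.range (J + 1), ((∑ x ∈ Pj j, ρ x : ℕ) : ℝ) := by
        push_cast; rfl
    _ ≤ (psB k : ℝ) ^ k * (N:ℝ) ^ (3 * k + 1) + ∑ j ∈ Finset.range (J + 1),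
      2 ^ k * (4 * k * (N:ℝ) ^ (2 * k + 1) + 16 * k ^ 2 * (N:ℝ) ^ (3 * k + 1) * (1 / 2) ^ j) :=
        add_le_add hp0 (Finset.sum_le_sum (fun j _ => hpj j))
    _ = (psB k : ℝ) ^ k * (N:ℝ) ^ (3 * k + 1) +
      2 ^ k * (4 * k * (((J + 1 : ℕ) : ℝ) * (N:ℝ) ^ (2 * k + 1)) + 16 * k ^ 2 * (N:ℝ) ^ (3 * k + 1)
        * ∑ j ∈ Finset.range (J + 1), ((1:ℝ) / 2) ^ j) := by
        rw [← Finset.mul_sum, Finset.sum_add_distrib, Finset.mul_sum (Finset.range (J + 1)) _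
          (16 * (k:ℝ) ^ 2 * (N:ℝ) ^ (3 * k + 1)), Finset.sum_const,
          Finset.card_range, nsmul_eq_mul]
        ring
    _ ≤ (psB k : ℝ) ^ k * (N:ℝ) ^ (3 * k + 1) +
      2 ^ k * (4 * k * ((2 * k + 2) * (N:ℝ) ^ (3 * k + 1)) + 16 * k ^ 2 * (N:ℝ) ^ (3 * k + 1)
        * 2) := by gcongr
    _ = _ := by ring

theorem pach_sharir_diagonal :
    ∀ k : ℕ, 1 ≤ k → ∃ c : ℝ, 0 < c ∧
      ∀ n : ℕ, 1 ≤ n → ∀ P : Finset (ℝ × ℝ), ∀ C : Finset (Set (ℝ × ℝ)),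
        P.card = n → C.card = n → KIntersecting C k →
        (incidences P C : ℝ) ≤ c * (n : ℝ) ^ ((3 * (k:ℝ) + 1) / (2 * (k:ℝ) + 1)) := by
  intro k hk
  have hk' : (0:ℝ) < k := by exact_mod_cast hk
  refine ⟨((psB k : ℝ) ^ k + 2 ^ k * (4 * k * (2 * k + 2) + 32 * k ^ 2)) * 2 ^ (3 * k + 1),
    by positivity, ?_⟩
  intro n hn P C hP hC hK
  have hn' : (1:ℝ) ≤ n := by exact_mod_cast hn
  have hn0 : (0:ℝ) ≤ n := by linarith
  set y : ℝ := (n:ℝ) ^ (1 / (2 * (k:ℝ) + 1)) with hy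
  have hy1 : 1 ≤ y := Real.one_le_rpow hn' (by positivity)
  have hypow : y ^ (2 * k + 1) = n := by
    rw [hy, ← Real.rpow_natCast, ← Real.rpow_mul hn0]
    push_cast
    rw [one_div_mul_cancel (by positivity), Real.rpow_one]
  have hypow' : y ^ (3 * k + 1) = (n:ℝ) ^ ((3 * (k:ℝ) + 1) / (2 * (k:ℝ) + 1)) := by
    rw [hy, ← Real.rpow_natCast, ← Real.rpow_mul hn0]
    push_cast
    congr 1
    ring
  have hyN : y ≤ (⌈y⌉₊ : ℝ) := Nat.le_ceil y
  have hN2 : (⌈y⌉₊ : ℝ) ≤ 2 * y := by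
    have := Nat.ceil_lt_add_one (show 0 ≤ y by linarith)
    linarith
  have hN1 : 1 ≤ ⌈y⌉₊ := Nat.one_le_ceil_iff.mpr (by linarith)
  have hnN : n ≤ ⌈y⌉₊ ^ (2 * k + 1) := by
    have : (n:ℝ) ≤ (⌈y⌉₊ : ℝ) ^ (2 * k + 1) := by
      rw [← hypow]
      exact pow_le_pow_left₀ (by linarith) hyN _
    exact_mod_cast this
  refine (ps_total k hk P C hK ⌈y⌉₊ hN1 (by omega) (by omega)).trans ?_
  rw [← hypow', mul_assoc _ (2 ^ (3 * k + 1) : ℝ), ← mul_pow]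
  gcongr
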